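/- arXiv:2507.06855 — 3 statements merged into one kernel-verified Lean document; each statement's English description precedes it below -/
import Mathlib

section
/- Let B be the open unit ball in ℂ^n, let φ: B → ℝ be smooth with positive definite complex Hessian g_{ij̄} = ∂_i∂_j̄φ at every point, and set h = exp(−φ). Define the (n+1)×(n+1) matrix-valued function H = (H^{ab̄})_{0≤a,b≤n} on B by H^{ab̄} = h u_a conj(u_b) + h g^{pq̄}(∂_p u_a + u_a h^{-1}∂_p h)·conj(∂_q u_b + u_b h^{-1}∂_q h), where u_0 = 1 and u_i = z^i for 1 ≤ i ≤ n. Then the Chern curvature F_{kl̄} = ∂_l̄((∂_k H)·H^{-1}) vanishes identically on B for all k, l if and only if R_{ij̄kl̄} = g_{ij̄}g_{kl̄} + g_{il̄}g_{kj̄} on B for all indices i,j,k,l (i.e. g has constant holomorphic sectional curvature κ = 2). -/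
noncomputable section
open Complex Matrix
open scoped ComplexOrder

/-- The Wirtinger derivative `∂ₖ f = (1/2)(∂f/∂xᵏ − i ∂f/∂yᵏ)` of a complex-valued
function on `ℂⁿ` (with its Euclidean structure), where `zᵏ = xᵏ + i yᵏ`. -/
def wd {n : ℕ} (k : Fin n) (f : EuclideanSpace ℂ (Fin n) → ℂ)
    (z : EuclideanSpace ℂ (Fin n)) : ℂ :=
  (1/2 : ℂ) * (fderiv ℝ f z (EuclideanSpace.single k 1)
    - Complex.I * fderiv ℝ f z (EuclideanSpace.single k Complex.I))

/-- The conjugate Wirtinger derivative `∂ₖ̄ f = (1/2)(∂f/∂xᵏ + i ∂f/∂yᵏ)`. -/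
def wdb {n : ℕ} (k : Fin n) (f : EuclideanSpace ℂ (Fin n) → ℂ)
    (z : EuclideanSpace ℂ (Fin n)) : ℂ :=
  (1/2 : ℂ) * (fderiv ℝ f z (EuclideanSpace.single k 1)
    + Complex.I * fderiv ℝ f z (EuclideanSpace.single k Complex.I))

/-- The inverse transpose matrix `(g^{ij̄})` of a matrix-valued function `(g_{ij̄})`. -/
def ginv {n : ℕ} (g : Fin n → Fin n → EuclideanSpace ℂ (Fin n) → ℂ)
    (z : EuclideanSpace ℂ (Fin n)) : Matrix (Fin n) (Fin n) ℂ :=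
  ((Matrix.of fun i j => g i j z)⁻¹)ᵀ

/-- The Riemann curvature tensor
`R_{ij̄kl̄} = −∂_k∂_l̄ g_{ij̄} + g^{pq̄}(∂_l̄ g_{pj̄})(∂_k g_{iq̄})`. -/
def Riem {n : ℕ} (g : Fin n → Fin n → EuclideanSpace ℂ (Fin n) → ℂ)
    (i j k l : Fin n) (z : EuclideanSpace ℂ (Fin n)) : ℂ :=
  - wd k (wdb l (g i j)) z
    + ∑ p, ∑ q, ginv g z p q * wdb l (g p j) z * wd k (g i q) z

/-- The complex Hessian `g_{ij̄} = ∂_i ∂_j̄ φ` of a real-valued function `φ`. -/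
def gmat {n : ℕ} (φ : EuclideanSpace ℂ (Fin n) → ℝ) (i j : Fin n)
    (z : EuclideanSpace ℂ (Fin n)) : ℂ :=
  wd i (wdb j (fun w => (φ w : ℂ))) z

/-- The functions `u_0 = 1`, `u_i = z^i` (`1 ≤ i ≤ n`), indexed by `Fin (n+1)`. -/
def uu {n : ℕ} (a : Fin (n + 1)) (z : EuclideanSpace ℂ (Fin n)) : ℂ :=
  if h : a = 0 then 1 else z (a.pred h)

/-- The matrix `H^{ab̄} = h u_a conj(u_b)
  + h g^{pq̄}(∂_p u_a + u_a h⁻¹ ∂_p h) conj(∂_q u_b + u_b h⁻¹ ∂_q h)`. -/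
def Hmat {n : ℕ} (h : EuclideanSpace ℂ (Fin n) → ℝ)
    (g : Fin n → Fin n → EuclideanSpace ℂ (Fin n) → ℂ)
    (a b : Fin (n + 1)) (z : EuclideanSpace ℂ (Fin n)) : ℂ :=
  (h z : ℂ) * uu a z * (starRingEnd ℂ) (uu b z)
    + (h z : ℂ) * ∑ p, ∑ q, ginv g z p q
        * (wd p (uu a) z + uu a z * (h z : ℂ)⁻¹ * wd p (fun w => (h w : ℂ)) z)
        * (starRingEnd ℂ)
            (wd q (uu b) z + uu b z * (h z : ℂ)⁻¹ * wd q (fun w => (h w : ℂ)) z)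

/-- The Chern curvature `F_{kl̄} = ∂_l̄ ((∂_k H) · H⁻¹)` of the matrix `H`. -/
def FH {n : ℕ} (h : EuclideanSpace ℂ (Fin n) → ℝ)
    (g : Fin n → Fin n → EuclideanSpace ℂ (Fin n) → ℂ)
    (k l : Fin n) (z : EuclideanSpace ℂ (Fin n)) :
    Matrix (Fin (n + 1)) (Fin (n + 1)) ℂ :=
  Matrix.of fun a b => wdb l (fun w =>
    ((Matrix.of fun a' b' => wd k (Hmat h g a' b') w)
      * (Matrix.of fun a' b' => Hmat h g a' b' w)⁻¹) a b) z

abbrev EE (n : ℕ) := EuclideanSpace ℂ (Fin n)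

def wg {n : ℕ} (c : ℂ) (k : Fin n) (f : EE n → ℂ) (z : EE n) : ℂ :=
  (1/2 : ℂ) * (fderiv ℝ f z (EuclideanSpace.single k 1)
    + c * fderiv ℝ f z (EuclideanSpace.single k Complex.I))

lemma wd_eq_wg {n : ℕ} (k : Fin n) (f : EE n → ℂ) : wd k f = wg (-Complex.I) k f := by
  funext z; simp only [wd, wg]; ring

lemma wdb_eq_wg {n : ℕ} (k : Fin n) (f : EE n → ℂ) : wdb k f = wg Complex.I k f := by
  funext z; simp only [wdb, wg]

abbrev BB (n : ℕ) : Set (EE n) := Metric.ball 0 1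

def Sm {n : ℕ} (f : EE n → ℂ) : Prop := ContDiffOn ℝ ((⊤ : ℕ∞) : WithTop ℕ∞) f (BB n)

lemma Sm.diff {n : ℕ} {f : EE n → ℂ} (hf : Sm f) {z : EE n} (hz : z ∈ BB n) :
    DifferentiableAt ℝ f z :=
  (ContDiffOn.contDiffAt hf (Metric.isOpen_ball.mem_nhds hz)).differentiableAt (by simp)

lemma Sm.add {n : ℕ} {f g : EE n → ℂ} (hf : Sm f) (hg : Sm g) : Sm (fun w => f w + g w) :=
  ContDiffOn.add hf hg

lemma Sm.mul {n : ℕ} {f g : EE n → ℂ} (hf : Sm f) (hg : Sm g) : Sm (fun w => f w * g w) :=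
  ContDiffOn.mul hf hg

lemma Sm.neg {n : ℕ} {f : EE n → ℂ} (hf : Sm f) : Sm (fun w => - f w) :=
  ContDiffOn.neg hf

lemma Sm.const {n : ℕ} (c : ℂ) : Sm (fun _ : EE n => c) := contDiffOn_const

lemma Sm.sum {n : ℕ} {α : Type*} {s : Finset α} {f : α → EE n → ℂ} (hf : ∀ a ∈ s, Sm (f a)) :
    Sm (fun w => ∑ a ∈ s, f a w) := ContDiffOn.sum hf

lemma Sm.congr {n : ℕ} {f g : EE n → ℂ} (hf : Sm f) (h : ∀ w ∈ BB n, g w = f w) : Sm g :=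
  ContDiffOn.congr hf h

lemma Sm.wg {n : ℕ} {f : EE n → ℂ} (hf : Sm f) (c : ℂ) (k : Fin n) : Sm (wg c k f) := by
  have h : ContDiffOn ℝ ((⊤ : ℕ∞) : WithTop ℕ∞) (fderiv ℝ f) (BB n) :=
    ContDiffOn.fderiv_of_isOpen hf Metric.isOpen_ball (by simp)
  have h2 : ∀ v : EE n, Sm (fun z => fderiv ℝ f z v) := fun v =>
    h.clm_apply contDiffOn_const
  exact (Sm.const _).mul ((h2 _).add ((Sm.const c).mul (h2 _)))

lemma wg_congr {n : ℕ} {f g : EE n → ℂ} (c : ℂ) (k : Fin n) (h : ∀ w ∈ BB n, f w = g w)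
    {z : EE n} (hz : z ∈ BB n) : wg c k f z = wg c k g z := by
  have : f =ᶠ[nhds z] g := by
    filter_upwards [Metric.isOpen_ball.mem_nhds hz] with w hw using h w hw
  simp only [wg, this.fderiv_eq]

lemma wg_add {n : ℕ} {f g : EE n → ℂ} (c : ℂ) (k : Fin n) (hf : Sm f) (hg : Sm g)
    {z : EE n} (hz : z ∈ BB n) : wg c k (fun w => f w + g w) z = wg c k f z + wg c k g z := by
  simp only [wg, fderiv_fun_add (hf.diff hz) (hg.diff hz), _root_.add_apply]
  ring

lemma wg_mul {n : ℕ} {f g : EE n → ℂ} (c : ℂ) (k : Fin n) (hf : Sm f) (hg : Sm g)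
    {z : EE n} (hz : z ∈ BB n) :
    wg c k (fun w => f w * g w) z = wg c k f z * g z + f z * wg c k g z := by
  simp only [wg, fderiv_fun_mul (hf.diff hz) (hg.diff hz), _root_.add_apply,
    _root_.smul_apply, smul_eq_mul]
  ring

lemma wg_neg {n : ℕ} {f : EE n → ℂ} (c : ℂ) (k : Fin n) {z : EE n} :
    wg c k (fun w => - f w) z = - wg c k f z := by
  simp only [wg, fderiv_fun_neg, _root_.neg_apply]
  ring

lemma wg_const {n : ℕ} (a : ℂ) (c : ℂ) (k : Fin n) {z : EE n} :
    wg c k (fun _ => a) z = 0 := by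
  simp [wg]

lemma wg_sum {n : ℕ} {α : Type*} {s : Finset α} {f : α → EE n → ℂ} (c : ℂ) (k : Fin n)
    (hf : ∀ a, Sm (f a)) {z : EE n} (hz : z ∈ BB n) :
    wg c k (fun w => ∑ a ∈ s, f a w) z = ∑ a ∈ s, wg c k (f a) z := by
  simp only [wg, fderiv_fun_sum (fun a _ => (hf a).diff hz), _root_.sum_apply,
    Finset.mul_sum, Finset.sum_add_distrib, mul_add]

lemma wg_comm {n : ℕ} {f : EE n → ℂ} (c d : ℂ) (k l : Fin n) (hf : Sm f)
    {z : EE n} (hz : z ∈ BB n) : wg c k (wg d l f) z = wg d l (wg c k f) z := by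
  have h : ContDiffOn ℝ ((⊤ : ℕ∞) : WithTop ℕ∞) (fderiv ℝ f) (BB n) :=
    ContDiffOn.fderiv_of_isOpen hf Metric.isOpen_ball (by simp)
  have hd : DifferentiableAt ℝ (fderiv ℝ f) z :=
    (h.contDiffAt (Metric.isOpen_ball.mem_nhds hz)).differentiableAt (by simp)
  have hs : IsSymmSndFDerivAt ℝ f z :=
    (ContDiffOn.contDiffAt hf (Metric.isOpen_ball.mem_nhds hz)).isSymmSndFDerivAt
      (by simp only [minSmoothness_of_isRCLikeNormedField]; exact WithTop.coe_le_coe.mpr (le_top : (2 : ℕ∞) ≤ ⊤))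
  have key : ∀ (d : ℂ) (l : Fin n) (v : EE n), fderiv ℝ (wg d l f) z v =
      (1/2 : ℂ) * (fderiv ℝ (fderiv ℝ f) z v (EuclideanSpace.single l 1)
        + d * fderiv ℝ (fderiv ℝ f) z v (EuclideanSpace.single l Complex.I)) := by
    intro d l v
    have h1 : ∀ u : EE n, HasFDerivAt (fun w => fderiv ℝ f w u)
        ((fderiv ℝ (fderiv ℝ f) z).flip u) z := fun u => by
      simpa using hd.hasFDerivAt.clm_apply (hasFDerivAt_const u z)
    have := ((h1 (EuclideanSpace.single l 1)).fun_add
      ((h1 (EuclideanSpace.single l Complex.I)).const_mul d)).const_mul (1/2 : ℂ)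
    have e := this.fderiv
    change fderiv ℝ (wg d l f) z = _ at e
    rw [e]
    simp [mul_add]
  simp only [wg.eq_1 c k (wg d l f), wg.eq_1 d l (wg c k f), key]
  rw [hs.eq (EuclideanSpace.single k 1) (EuclideanSpace.single l 1),
    hs.eq (EuclideanSpace.single k 1) (EuclideanSpace.single l Complex.I),
    hs.eq (EuclideanSpace.single k Complex.I) (EuclideanSpace.single l 1),
    hs.eq (EuclideanSpace.single k Complex.I) (EuclideanSpace.single l Complex.I)]
  ring

/-! matrices -/

def MSm {n : ℕ} {α : Type*} (M : EE n → Matrix α α ℂ) : Prop := ∀ a b, Sm (fun w => M w a b)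

def mD {n : ℕ} {α : Type*} (c : ℂ) (k : Fin n) (M : EE n → Matrix α α ℂ) (z : EE n) :
    Matrix α α ℂ := Matrix.of fun a b => wg c k (fun w => M w a b) z

section mats
set_option linter.unusedSectionVars false
variable {n : ℕ} {α : Type*} [Fintype α] [DecidableEq α] {M N : EE n → Matrix α α ℂ}

lemma MSm.mul (hM : MSm M) (hN : MSm N) : MSm (fun w => M w * N w) := fun a b => by
  simp only [Matrix.mul_apply]
  exact Sm.sum fun c _ => (hM a c).mul (hN c b)

lemma MSm.mD (hM : MSm M) (c : ℂ) (k : Fin n) : MSm (mD c k M) := fun a b => (hM a b).wg c k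

lemma MSm.det (hM : MSm M) : Sm (fun w => (M w).det) := by
  simp only [Matrix.det_apply']
  exact Sm.sum fun σ _ => (Sm.const _).mul (contDiffOn_prod fun i _ => hM _ _)

lemma MSm.inv (hM : MSm M) (h : ∀ w ∈ BB n, (M w).det ≠ 0) : MSm (fun w => (M w)⁻¹) := fun a b => by
  have h1 : Sm (fun w => (M w).det⁻¹) := ContDiffOn.inv hM.det h
  have h2 : Sm (fun w => (M w).adjugate a b) := by
    simp only [Matrix.adjugate_apply]
    refine MSm.det (M := fun w => (M w).updateRow b (Pi.single a 1)) fun i j => ?_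
    by_cases hi : i = b
    · subst hi; simp only [Matrix.updateRow_self]; exact Sm.const _
    · simp only [Matrix.updateRow_ne hi]; exact hM i j
  refine (h1.mul h2).congr fun w _ => ?_
  simp [Matrix.inv_def]

lemma mD_mul (c : ℂ) (k : Fin n) (hM : MSm M) (hN : MSm N) {z : EE n} (hz : z ∈ BB n) :
    mD c k (fun w => M w * N w) z = mD c k M z * N z + M z * mD c k N z := by
  ext a b
  simp only [mD, Matrix.mul_apply, Matrix.of_apply, Matrix.add_apply]
  rw [wg_sum c k (fun x => (hM a x).mul (hN x b)) hz, ← Finset.sum_add_distrib]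
  exact Finset.sum_congr rfl fun x _ => wg_mul c k (hM a x) (hN x b) hz

lemma mD_congr (c : ℂ) (k : Fin n) (h : ∀ w ∈ BB n, M w = N w) {z : EE n} (hz : z ∈ BB n) :
    mD c k M z = mD c k N z := by
  ext a b
  exact wg_congr c k (fun w hw => by rw [h w hw]) hz

lemma mD_const (c : ℂ) (k : Fin n) (A : Matrix α α ℂ) {z : EE n} :
    mD c k (fun _ => A) z = 0 := by
  ext a b
  exact wg_const _ c k

/-- derivative of an inverse -/
lemma mD_inv (c : ℂ) (k : Fin n) (hM : MSm M) (hN : MSm N) (h : ∀ w ∈ BB n, M w * N w = 1)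
    {z : EE n} (hz : z ∈ BB n) : mD c k N z = - (N z * mD c k M z * N z) := by
  have e := mD_mul c k hM hN hz
  rw [mD_congr c k h hz, mD_const] at e
  have h2 : N z * M z = 1 := mul_eq_one_comm.mp (h z hz)
  have e2 : N z * (mD c k M z * N z + M z * mD c k N z) = 0 := by rw [← e]; simp
  rw [mul_add, ← mul_assoc (N z) (M z), h2, one_mul, ← mul_assoc] at e2
  exact eq_neg_of_add_eq_zero_right e2

/-- Curvature of `P K R` with `P` holomorphic and `R` antiholomorphic. -/
lemma curv_key {P Q R S K L : EE n → Matrix α α ℂ} (d c : ℂ) (k l : Fin n)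
    (hP : MSm P) (hQ : MSm Q) (hR : MSm R) (hK : MSm K) (hL : MSm L)
    (hPQ : ∀ w ∈ BB n, P w * Q w = 1) (hRS : ∀ w ∈ BB n, R w * S w = 1)
    (hLK : ∀ w ∈ BB n, L w * K w = 1)
    (dP : ∀ w ∈ BB n, mD c l P w = 0)
    (dR : ∀ w ∈ BB n, mD d k R w = 0) {z : EE n} (hz : z ∈ BB n) :
    mD c l (fun w => mD d k (fun x => P x * K x * R x) w * (P w * K w * R w)⁻¹) z
      = P z * K z * (mD c l L z * K z * mD d k L z - mD c l (mD d k L) z) * Q z := by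
  have h1 : ∀ w ∈ BB n, mD d k (fun x => P x * K x * R x) w * (P w * K w * R w)⁻¹
      = mD d k P w * Q w - P w * (K w * mD d k L w) * Q w := by
    intro w hw
    have i : (P w * K w * R w)⁻¹ = S w * L w * Q w := by
      apply Matrix.inv_eq_left_inv
      calc S w * L w * Q w * (P w * K w * R w)
          = S w * (L w * ((Q w * P w) * K w)) * R w := by noncomm_ring
        _ = 1 := by
          rw [mul_eq_one_comm.mp (hPQ w hw), one_mul, hLK w hw, mul_one,
            mul_eq_one_comm.mp (hRS w hw)]
    rw [i, mD_mul d k (hP.mul hK) hR hw, dR w hw, mD_mul d k hP hK hw,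
      mD_inv d k hL hK hLK hw]
    have hKL := mul_eq_one_comm.mp (hLK w hw)
    calc _ = mD d k P w * (K w * (R w * S w) * L w) * Q w
          - P w * (K w * mD d k L w * (K w * (R w * S w) * L w)) * Q w := by noncomm_ring
      _ = _ := by rw [hRS w hw, mul_one, hKL]; noncomm_ring
  have dQ : mD c l Q z = 0 := by rw [mD_inv c l hP hQ hPQ hz, dP z hz]; simp
  have dPP : mD c l (mD d k P) z = 0 := by
    have : mD c l (mD d k P) z = mD d k (mD c l P) z := by
      ext a b
      exact wg_comm c d l k (hP a b) hz
    rw [this, mD_congr d k dP hz]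
    exact mD_const d k 0
  rw [mD_congr c l h1 hz]
  have hs : ∀ w ∈ BB n, mD d k P w * Q w - P w * (K w * mD d k L w) * Q w
      = (mD d k P w + (-1 : Matrix α α ℂ) * (P w * (K w * mD d k L w))) * Q w := by
    intro w _; noncomm_ring
  have c1 : MSm (fun _ : EE n => (-1 : Matrix α α ℂ)) := fun a b => Sm.const _
  have hPKL := hP.mul (hK.mul (hL.mD d k))
  have hadd : MSm (fun w => mD d k P w + (-1 : Matrix α α ℂ) * (P w * (K w * mD d k L w))) :=
    fun a b => (hP.mD d k a b).add (c1.mul hPKL a b)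
  have eadd : mD c l (fun w => mD d k P w + (-1 : Matrix α α ℂ) * (P w * (K w * mD d k L w))) z
      = mD c l (mD d k P) z + mD c l (fun w => (-1 : Matrix α α ℂ) * (P w * (K w * mD d k L w))) z := by
    ext a b
    exact wg_add c l (hP.mD d k a b) (c1.mul hPKL a b) hz
  rw [mD_congr c l hs hz, mD_mul c l hadd hQ hz, dQ, eadd, dPP, mD_mul c l c1 hPKL hz, mD_const,
    mD_mul c l hP (hK.mul (hL.mD d k)) hz, dP z hz, mD_mul c l hK (hL.mD d k) hz,
    mD_inv c l hL hK hLK hz]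
  noncomm_ring

end mats

section blocks
variable {n : ℕ}

/-- the block matrix `[[1,0],[v,I]]` -/
def low (v : Fin n → ℂ) : Matrix (Fin (n+1)) (Fin (n+1)) ℂ :=
  Matrix.of fun a b => Fin.cases (motive := fun _ => ℂ)
    (Fin.cases (motive := fun _ => ℂ) 1 (fun _ => 0) b)
    (fun i => Fin.cases (motive := fun _ => ℂ) (v i) (fun j => if i = j then 1 else 0) b) a

/-- the block matrix `diag(a, A)` -/
def bd (c : ℂ) (A : Matrix (Fin n) (Fin n) ℂ) : Matrix (Fin (n+1)) (Fin (n+1)) ℂ :=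
  Matrix.of fun a b => Fin.cases (motive := fun _ => ℂ)
    (Fin.cases (motive := fun _ => ℂ) c (fun _ => 0) b)
    (fun i => Fin.cases (motive := fun _ => ℂ) 0 (fun j => A i j) b) a

@[simp] lemma low_00 (v : Fin n → ℂ) : low v 0 0 = 1 := rfl
@[simp] lemma low_0s (v : Fin n → ℂ) (i : Fin n) : low v 0 i.succ = 0 := rfl
@[simp] lemma low_s0 (v : Fin n → ℂ) (i : Fin n) : low v i.succ 0 = v i := rfl
@[simp] lemma low_ss (v : Fin n → ℂ) (i j : Fin n) :
    low v i.succ j.succ = if i = j then 1 else 0 := rfl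
@[simp] lemma bd_00 (c : ℂ) (A : Matrix (Fin n) (Fin n) ℂ) : bd c A 0 0 = c := rfl
@[simp] lemma bd_0s (c : ℂ) (A : Matrix (Fin n) (Fin n) ℂ) (i : Fin n) : bd c A 0 i.succ = 0 := rfl
@[simp] lemma bd_s0 (c : ℂ) (A : Matrix (Fin n) (Fin n) ℂ) (i : Fin n) : bd c A i.succ 0 = 0 := rfl
@[simp] lemma bd_ss (c : ℂ) (A : Matrix (Fin n) (Fin n) ℂ) (i j : Fin n) :
    bd c A i.succ j.succ = A i j := rfl

lemma low_mul (v w : Fin n → ℂ) (h : ∀ i, v i + w i = 0) : low v * low w = 1 := by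
  ext a b
  refine Fin.cases ?_ (fun i => ?_) a <;> refine Fin.cases ?_ (fun j => ?_) b <;>
    simp [Matrix.mul_apply, Fin.sum_univ_succ, Matrix.one_apply, h, Fin.succ_ne_zero,
      (Fin.succ_ne_zero _).symm]

lemma lowT_mul (v w : Fin n → ℂ) (h : ∀ i, v i + w i = 0) : (low v)ᵀ * (low w)ᵀ = 1 := by
  rw [← Matrix.transpose_mul, low_mul w v (fun i => by rw [add_comm, h]), Matrix.transpose_one]

lemma bd_mul (c d : ℂ) (A B : Matrix (Fin n) (Fin n) ℂ) (h : c * d = 1) (h2 : A * B = 1) :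
    bd c A * bd d B = 1 := by
  ext a b
  refine Fin.cases ?_ (fun i => ?_) a <;> refine Fin.cases ?_ (fun j => ?_) b <;>
    simp [Matrix.mul_apply, Fin.sum_univ_succ, Matrix.one_apply, h, Fin.succ_ne_zero,
      (Fin.succ_ne_zero _).symm]
  have := congrFun (congrFun h2 i) j
  simpa [Matrix.mul_apply, Matrix.one_apply] using this

lemma mul_bd_mul (U V : Matrix (Fin (n+1)) (Fin (n+1)) ℂ) (c : ℂ) (A : Matrix (Fin n) (Fin n) ℂ)
    (x y : Fin (n+1)) : (U * bd c A * V) x y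
      = U x 0 * c * V 0 y + ∑ r : Fin n, ∑ s : Fin n, U x r.succ * A r s * V s.succ y := by
  simp only [Matrix.mul_apply, Fin.sum_univ_succ, bd_00, bd_0s, bd_s0, bd_ss, mul_zero,
    Finset.sum_const_zero, add_zero, zero_add, Finset.sum_mul]
  rw [Finset.sum_comm]

lemma mul_lowT_0 (X : Matrix (Fin (n+1)) (Fin (n+1)) ℂ) (v : Fin n → ℂ) (a : Fin (n+1)) :
    (X * (low v)ᵀ) a 0 = X a 0 := by
  simp [Matrix.mul_apply, Fin.sum_univ_succ]

lemma mul_lowT_s (X : Matrix (Fin (n+1)) (Fin (n+1)) ℂ) (v : Fin n → ℂ) (a : Fin (n+1)) (i : Fin n) :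
    (X * (low v)ᵀ) a i.succ = X a i.succ + X a 0 * v i := by
  simp [Matrix.mul_apply, Fin.sum_univ_succ, add_comm]

lemma low_mul_0 (X : Matrix (Fin (n+1)) (Fin (n+1)) ℂ) (v : Fin n → ℂ) (b : Fin (n+1)) :
    (low v * X) 0 b = X 0 b := by
  simp [Matrix.mul_apply, Fin.sum_univ_succ]

lemma low_mul_s (X : Matrix (Fin (n+1)) (Fin (n+1)) ℂ) (v : Fin n → ℂ) (b : Fin (n+1)) (i : Fin n) :
    (low v * X) i.succ b = X i.succ b + v i * X 0 b := by
  simp [Matrix.mul_apply, Fin.sum_univ_succ, add_comm]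

lemma contraction (gi g : Fin n → Fin n → ℂ) (x y : Fin n → ℂ) (a b c d : ℂ) (i j k l : Fin n)
    (h1 : ∀ s j, ∑ r, gi r s * g r j = if s = j then 1 else 0)
    (h2 : ∀ r i, ∑ s, gi r s * g i s = if r = i then 1 else 0) :
    ∑ r, ∑ s, (x r + a * g r l + b * g r j) * gi r s * (y s + c * g i s + d * g k s)
      = ∑ r, ∑ s, gi r s * x r * y s + c * x i + d * x k
        + a * (y l + c * g i l + d * g k l) + b * (y j + c * g i j + d * g k j) := by
  have e1 : ∀ (m : Fin n) (Y : Fin n → ℂ), ∑ r, ∑ s, g r m * gi r s * Y s = Y m := by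
    intro m Y
    rw [Finset.sum_comm]
    have : ∀ s, ∑ r, g r m * gi r s * Y s = (if s = m then 1 else 0) * Y s := by
      intro s
      rw [← h1 s m, Finset.sum_mul]
      exact Finset.sum_congr rfl fun r _ => by ring
    simp [this]
  have e2 : ∀ (m : Fin n), ∑ r, ∑ s, x r * gi r s * g m s = x m := by
    intro m
    have : ∀ r, ∑ s, x r * gi r s * g m s = x r * (if r = m then 1 else 0) := by
      intro r
      rw [← h2 r m, Finset.mul_sum]
      exact Finset.sum_congr rfl fun s _ => by ring
    simp [this]
  have e3 : ∑ r, ∑ s, (x r + a * g r l + b * g r j) * gi r s * (y s + c * g i s + d * g k s)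
      = (∑ r, ∑ s, gi r s * x r * y s) + c * (∑ r, ∑ s, x r * gi r s * g i s)
        + d * (∑ r, ∑ s, x r * gi r s * g k s)
        + a * (∑ r, ∑ s, g r l * gi r s * (y s + c * g i s + d * g k s))
        + b * (∑ r, ∑ s, g r j * gi r s * (y s + c * g i s + d * g k s)) := by
    simp only [Finset.mul_sum, ← Finset.sum_add_distrib]
    exact Finset.sum_congr rfl fun r _ => Finset.sum_congr rfl fun s _ => by ring
  rw [e3, e2, e2, e1, e1]

end blocks

section coords
variable {n : ℕ}

lemma sm_coord (i : Fin n) : Sm (fun w : EE n => w i) :=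
  (((EuclideanSpace.proj i : EE n →L[ℂ] ℂ).restrictScalars ℝ).contDiff).contDiffOn

lemma sm_coord_conj (i : Fin n) : Sm (fun w : EE n => (starRingEnd ℂ) (w i)) :=
  ((Complex.conjCLE.toContinuousLinearMap.comp
    ((EuclideanSpace.proj i : EE n →L[ℂ] ℂ).restrictScalars ℝ)).contDiff).contDiffOn

lemma wg_coord (c : ℂ) (p i : Fin n) (z : EE n) :
    wg c p (fun w : EE n => w i) z = if i = p then (1/2 : ℂ) * (1 + c * Complex.I) else 0 := by
  have : fderiv ℝ (fun w : EE n => w i) z = (EuclideanSpace.proj i : EE n →L[ℂ] ℂ).restrictScalars ℝ :=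
    ((EuclideanSpace.proj i : EE n →L[ℂ] ℂ).restrictScalars ℝ).fderiv
  simp only [wg, this]
  by_cases h : i = p <;> simp [h]

lemma wg_coord_conj (c : ℂ) (p i : Fin n) (z : EE n) :
    wg c p (fun w : EE n => (starRingEnd ℂ) (w i)) z
      = if i = p then (1/2 : ℂ) * (1 - c * Complex.I) else 0 := by
  have : fderiv ℝ (fun w : EE n => (starRingEnd ℂ) (w i)) z = (Complex.conjCLE.toContinuousLinearMap.comp
    ((EuclideanSpace.proj i : EE n →L[ℂ] ℂ).restrictScalars ℝ)) :=
    (Complex.conjCLE.toContinuousLinearMap.comp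
    ((EuclideanSpace.proj i : EE n →L[ℂ] ℂ).restrictScalars ℝ)).fderiv
  simp only [wg, this]
  by_cases h : i = p <;> simp [h, sub_eq_add_neg]

lemma MSm_low {v : EE n → Fin n → ℂ} (h : ∀ i, Sm (fun w => v w i)) : MSm (fun w => low (v w)) := by
  intro a b
  refine Fin.cases ?_ (fun i => ?_) a <;> refine Fin.cases ?_ (fun j => ?_) b <;>
    simp only [low_00, low_0s, low_s0, low_ss] <;> first | exact Sm.const _ | exact h _

lemma MSm.T {α : Type*} {M : EE n → Matrix α α ℂ} (h : MSm M) : MSm (fun w => (M w)ᵀ) :=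
  fun a b => h b a

lemma mD_T {α : Type*} (c : ℂ) (k : Fin n) (M : EE n → Matrix α α ℂ) (z : EE n) :
    mD c k (fun w => (M w)ᵀ) z = (mD c k M z)ᵀ := rfl

lemma mD_low (c : ℂ) (k : Fin n) {v : EE n → Fin n → ℂ} {z : EE n}
    (h : ∀ i, wg c k (fun w => v w i) z = 0) : mD c k (fun w => low (v w)) z = 0 := by
  ext a b
  refine Fin.cases ?_ (fun i => ?_) a <;> refine Fin.cases ?_ (fun j => ?_) b <;>
    simp only [mD, low_00, low_0s, low_s0, low_ss, Matrix.of_apply, wg_const, h, Matrix.zero_apply]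

lemma MSm_bd {c : EE n → ℂ} {A : EE n → Matrix (Fin n) (Fin n) ℂ} (hc : Sm c) (hA : MSm A) :
    MSm (fun w => bd (c w) (A w)) := by
  intro a b
  refine Fin.cases ?_ (fun i => ?_) a <;> refine Fin.cases ?_ (fun j => ?_) b <;>
    simp only [bd_00, bd_0s, bd_s0, bd_ss] <;> first | exact Sm.const _ | exact hc | exact hA _ _

lemma uu_zero : (uu 0 : EE n → ℂ) = fun _ => 1 := by funext z; simp [uu]
lemma uu_succ (i : Fin n) : (uu i.succ : EE n → ℂ) = fun w => w i := by
  funext z; simp [uu, Fin.succ_ne_zero]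

end coords

section main
variable {n : ℕ}

/-- `φ` as a complex function. -/
def fC (φ : EE n → ℝ) : EE n → ℂ := fun w => (φ w : ℂ)
def pp (φ : EE n → ℝ) (i : Fin n) : EE n → ℂ := wg (-Complex.I) i (fC φ)
def qq (φ : EE n → ℝ) (i : Fin n) : EE n → ℂ := wg Complex.I i (fC φ)
def psi (φ : EE n → ℝ) : EE n → ℂ := fun w => Complex.exp (fC φ w)
def hh (φ : EE n → ℝ) : EE n → ℂ := fun w => Complex.exp (- fC φ w)

lemma gmat_eq (φ : EE n → ℝ) (i j : Fin n) : gmat φ i j = wg (-Complex.I) i (qq φ j) := by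
  funext z
  simp only [gmat, wd_eq_wg, wdb_eq_wg]
  rfl

variable {φ : EE n → ℝ}

lemma sm_fC (hφ : ContDiffOn ℝ (⊤ : ℕ∞) φ (Metric.ball 0 1)) : Sm (fC φ) := Complex.ofRealCLM.contDiff.comp_contDiffOn hφ
lemma sm_pp (hφ : ContDiffOn ℝ (⊤ : ℕ∞) φ (Metric.ball 0 1)) (i : Fin n) : Sm (pp φ i) := (sm_fC hφ).wg _ _
lemma sm_qq (hφ : ContDiffOn ℝ (⊤ : ℕ∞) φ (Metric.ball 0 1)) (i : Fin n) : Sm (qq φ i) := (sm_fC hφ).wg _ _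
lemma sm_g (hφ : ContDiffOn ℝ (⊤ : ℕ∞) φ (Metric.ball 0 1)) (i j : Fin n) : Sm (gmat φ i j) := by
  rw [gmat_eq]; exact (sm_qq hφ j).wg _ _
lemma sm_psi (hφ : ContDiffOn ℝ (⊤ : ℕ∞) φ (Metric.ball 0 1)) : Sm (psi φ) := ContDiffOn.cexp (sm_fC hφ)
lemma sm_hh (hφ : ContDiffOn ℝ (⊤ : ℕ∞) φ (Metric.ball 0 1)) : Sm (hh φ) := ContDiffOn.cexp (sm_fC hφ).neg

lemma wg_psi (hφ : ContDiffOn ℝ (⊤ : ℕ∞) φ (Metric.ball 0 1)) (c : ℂ) (k : Fin n) {z : EE n} (hz : z ∈ BB n) :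
    wg c k (psi φ) z = psi φ z * wg c k (fC φ) z := by
  have : fderiv ℝ (psi φ) z = psi φ z • fderiv ℝ (fC φ) z :=
    (((sm_fC hφ).diff hz).hasFDerivAt.cexp).fderiv
  simp only [wg, this, _root_.smul_apply, smul_eq_mul]
  ring

lemma wg_hh (hφ : ContDiffOn ℝ (⊤ : ℕ∞) φ (Metric.ball 0 1)) (c : ℂ) (k : Fin n) {z : EE n} (hz : z ∈ BB n) :
    wg c k (hh φ) z = - (hh φ z * wg c k (fC φ) z) := by
  have : fderiv ℝ (hh φ) z = hh φ z • (- fderiv ℝ (fC φ) z) :=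
    (((sm_fC hφ).diff hz).hasFDerivAt.neg.cexp).fderiv
  simp only [wg, this, _root_.smul_apply, smul_eq_mul, _root_.neg_apply]
  ring

lemma conj_pp (hφ : ContDiffOn ℝ (⊤ : ℕ∞) φ (Metric.ball 0 1)) (i : Fin n) {z : EE n} (hz : z ∈ BB n) :
    (starRingEnd ℂ) (pp φ i z) = qq φ i z := by
  have hd : DifferentiableAt ℝ φ z :=
    (hφ.contDiffAt (Metric.isOpen_ball.mem_nhds hz)).differentiableAt (by simp)
  have : ∀ v, fderiv ℝ (fC φ) z v = ((fderiv ℝ φ z v : ℝ) : ℂ) := by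
    intro v
    have h := (Complex.ofRealCLM.hasFDerivAt.comp z hd.hasFDerivAt).fderiv
    change fderiv ℝ (fC φ) z = _ at h
    rw [h]; simp
  simp only [pp, qq, wg, this]
  simp only [map_mul, map_add, map_neg, Complex.conj_ofReal, Complex.conj_I, neg_neg, map_div₀, map_one, map_ofNat]

lemma wd_pp_comm (hφ : ContDiffOn ℝ (⊤ : ℕ∞) φ (Metric.ball 0 1)) (i l : Fin n) {z : EE n} (hz : z ∈ BB n) :
    wg Complex.I l (pp φ i) z = gmat φ i l z := by
  rw [gmat_eq]
  exact wg_comm _ _ _ _ (sm_fC hφ) hz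

lemma psi_hh (z : EE n) : psi φ z * hh φ z = 1 := by
  simp [psi, hh, ← Complex.exp_add]

def Gm (φ : EE n → ℝ) (z : EE n) : Matrix (Fin n) (Fin n) ℂ := Matrix.of fun i j => gmat φ i j z

def Km (φ : EE n → ℝ) (z : EE n) : Matrix (Fin (n+1)) (Fin (n+1)) ℂ :=
  (low (fun i => - pp φ i z))ᵀ * bd (hh φ z) (hh φ z • ginv (gmat φ) z) * low (fun i => - qq φ i z)

def Lm (φ : EE n → ℝ) (z : EE n) : Matrix (Fin (n+1)) (Fin (n+1)) ℂ :=
  low (fun i => qq φ i z) * bd (psi φ z) (psi φ z • (Gm φ z)ᵀ) * (low (fun i => pp φ i z))ᵀ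

lemma Lm_00 (z : EE n) : Lm φ z 0 0 = psi φ z := by
  simp [Lm, mul_lowT_0, low_mul_0]
lemma Lm_0s (z : EE n) (i : Fin n) : Lm φ z 0 i.succ = psi φ z * pp φ i z := by
  rw [Lm, mul_bd_mul]; simp
lemma Lm_s0 (z : EE n) (j : Fin n) : Lm φ z j.succ 0 = psi φ z * qq φ j z := by
  rw [Lm, mul_bd_mul]; simp [mul_comm]
lemma Lm_ss (z : EE n) (i j : Fin n) :
    Lm φ z j.succ i.succ = psi φ z * (gmat φ i j z + pp φ i z * qq φ j z) := by
  rw [Lm, mul_bd_mul]; simp [Gm]; ring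

lemma Lm_sm (hφ : ContDiffOn ℝ (⊤ : ℕ∞) φ (Metric.ball 0 1)) : MSm (Lm φ) := by
  refine ((MSm_low fun i => sm_qq hφ i).mul (MSm_bd (sm_psi hφ) ?_)).mul (MSm_low fun i => sm_pp hφ i).T
  intro a b
  exact (sm_psi hφ).mul (sm_g hφ b a)

lemma wd_L00 (hφ : ContDiffOn ℝ (⊤ : ℕ∞) φ (Metric.ball 0 1)) (k : Fin n) {z : EE n} (hz : z ∈ BB n) :
    mD (-Complex.I) k (Lm φ) z 0 0 = psi φ z * pp φ k z := by
  simp only [mD, Matrix.of_apply, Lm_00]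
  exact wg_psi hφ _ _ hz

lemma wdb_L00 (hφ : ContDiffOn ℝ (⊤ : ℕ∞) φ (Metric.ball 0 1)) (l : Fin n) {z : EE n} (hz : z ∈ BB n) :
    mD Complex.I l (Lm φ) z 0 0 = psi φ z * qq φ l z := by
  simp only [mD, Matrix.of_apply, Lm_00]
  exact wg_psi hφ _ _ hz

lemma wd_L0s (hφ : ContDiffOn ℝ (⊤ : ℕ∞) φ (Metric.ball 0 1)) (k i : Fin n) {z : EE n} (hz : z ∈ BB n) :
    mD (-Complex.I) k (Lm φ) z 0 i.succ
      = psi φ z * (pp φ k z * pp φ i z + wg (-Complex.I) k (pp φ i) z) := by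
  simp only [mD, Matrix.of_apply, Lm_0s]
  rw [wg_mul _ _ (sm_psi hφ) (sm_pp hφ i) hz, wg_psi hφ _ _ hz]
  change psi φ z * pp φ k z * _ + _ = _
  ring

lemma wdb_L0s (hφ : ContDiffOn ℝ (⊤ : ℕ∞) φ (Metric.ball 0 1)) (l i : Fin n) {z : EE n} (hz : z ∈ BB n) :
    mD Complex.I l (Lm φ) z 0 i.succ
      = psi φ z * (gmat φ i l z + pp φ i z * qq φ l z) := by
  simp only [mD, Matrix.of_apply, Lm_0s]
  rw [wg_mul _ _ (sm_psi hφ) (sm_pp hφ i) hz, wg_psi hφ _ _ hz, wd_pp_comm hφ _ _ hz]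
  change psi φ z * qq φ l z * _ + _ = _
  ring

lemma wd_Ls0 (hφ : ContDiffOn ℝ (⊤ : ℕ∞) φ (Metric.ball 0 1)) (k j : Fin n) {z : EE n} (hz : z ∈ BB n) :
    mD (-Complex.I) k (Lm φ) z j.succ 0
      = psi φ z * (gmat φ k j z + pp φ k z * qq φ j z) := by
  simp only [mD, Matrix.of_apply, Lm_s0]
  rw [wg_mul _ _ (sm_psi hφ) (sm_qq hφ j) hz, wg_psi hφ _ _ hz, gmat_eq]
  change psi φ z * pp φ k z * _ + _ = _
  ring

lemma wdb_Ls0 (hφ : ContDiffOn ℝ (⊤ : ℕ∞) φ (Metric.ball 0 1)) (l j : Fin n) {z : EE n} (hz : z ∈ BB n) :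
    mD Complex.I l (Lm φ) z j.succ 0
      = psi φ z * (qq φ l z * qq φ j z + wg Complex.I l (qq φ j) z) := by
  simp only [mD, Matrix.of_apply, Lm_s0]
  rw [wg_mul _ _ (sm_psi hφ) (sm_qq hφ j) hz, wg_psi hφ _ _ hz]
  change psi φ z * qq φ l z * _ + _ = _
  ring

lemma wd_Lss (hφ : ContDiffOn ℝ (⊤ : ℕ∞) φ (Metric.ball 0 1)) (k i j : Fin n) {z : EE n} (hz : z ∈ BB n) :
    mD (-Complex.I) k (Lm φ) z j.succ i.succ
      = psi φ z * (pp φ k z * (gmat φ i j z + pp φ i z * qq φ j z)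
        + (wg (-Complex.I) k (gmat φ i j) z
          + (wg (-Complex.I) k (pp φ i) z * qq φ j z + pp φ i z * gmat φ k j z))) := by
  simp only [mD, Matrix.of_apply, Lm_ss]
  rw [wg_mul _ _ (sm_psi hφ) ((sm_g hφ i j).add ((sm_pp hφ i).mul (sm_qq hφ j))) hz,
    wg_psi hφ _ _ hz, wg_add _ _ (sm_g hφ i j) ((sm_pp hφ i).mul (sm_qq hφ j)) hz,
    wg_mul _ _ (sm_pp hφ i) (sm_qq hφ j) hz, ← gmat_eq]
  change psi φ z * pp φ k z * _ + _ = _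
  ring

lemma wdb_Lss (hφ : ContDiffOn ℝ (⊤ : ℕ∞) φ (Metric.ball 0 1)) (l i j : Fin n) {z : EE n} (hz : z ∈ BB n) :
    mD Complex.I l (Lm φ) z j.succ i.succ
      = psi φ z * (qq φ l z * (gmat φ i j z + pp φ i z * qq φ j z)
        + (wg Complex.I l (gmat φ i j) z
          + (gmat φ i l z * qq φ j z + pp φ i z * wg Complex.I l (qq φ j) z))) := by
  simp only [mD, Matrix.of_apply, Lm_ss]
  rw [wg_mul _ _ (sm_psi hφ) ((sm_g hφ i j).add ((sm_pp hφ i).mul (sm_qq hφ j))) hz,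
    wg_psi hφ _ _ hz, wg_add _ _ (sm_g hφ i j) ((sm_pp hφ i).mul (sm_qq hφ j)) hz,
    wg_mul _ _ (sm_pp hφ i) (sm_qq hφ j) hz, wd_pp_comm hφ _ _ hz]
  change psi φ z * qq φ l z * _ + _ = _
  ring

lemma wdb_wd_pp (hφ : ContDiffOn ℝ (⊤ : ℕ∞) φ (Metric.ball 0 1)) (k l i : Fin n) {z : EE n} (hz : z ∈ BB n) :
    wg Complex.I l (wg (-Complex.I) k (pp φ i)) z = wg (-Complex.I) k (gmat φ i l) z := by
  rw [wg_comm _ _ _ _ (sm_pp hφ i) hz]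
  exact wg_congr _ _ (fun w hw => wd_pp_comm hφ i l hw) hz

lemma wdb_wd_Lss (hφ : ContDiffOn ℝ (⊤ : ℕ∞) φ (Metric.ball 0 1)) (k l i j : Fin n) {z : EE n} (hz : z ∈ BB n) :
    mD Complex.I l (mD (-Complex.I) k (Lm φ)) z j.succ i.succ
      = psi φ z * (qq φ l z * (pp φ k z * (gmat φ i j z + pp φ i z * qq φ j z)
        + (wg (-Complex.I) k (gmat φ i j) z
          + (wg (-Complex.I) k (pp φ i) z * qq φ j z + pp φ i z * gmat φ k j z)))
        + (gmat φ k l z * (gmat φ i j z + pp φ i z * qq φ j z)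
          + pp φ k z * (wg Complex.I l (gmat φ i j) z
            + (gmat φ i l z * qq φ j z + pp φ i z * wg Complex.I l (qq φ j) z))
          + (wg (-Complex.I) k (wg Complex.I l (gmat φ i j)) z
            + (wg (-Complex.I) k (gmat φ i l) z * qq φ j z
              + wg (-Complex.I) k (pp φ i) z * wg Complex.I l (qq φ j) z
              + (gmat φ i l z * gmat φ k j z + pp φ i z * wg Complex.I l (gmat φ k j) z))))) := by
  rw [mD, Matrix.of_apply, wg_congr _ _ (fun w hw => wd_Lss hφ k i j hw) hz]
  have s1 := (sm_g hφ i j).add ((sm_pp hφ i).mul (sm_qq hφ j))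
  have s2 := (sm_pp hφ k).mul s1
  have s3 := ((sm_pp hφ i).wg (-Complex.I) k).mul (sm_qq hφ j)
  have s4 := (sm_pp hφ i).mul (sm_g hφ k j)
  have s5 := (sm_g hφ i j).wg (-Complex.I) k
  rw [wg_mul _ _ (sm_psi hφ) (s2.add (s5.add (s3.add s4))) hz, wg_psi hφ _ _ hz,
    wg_add _ _ s2 (s5.add (s3.add s4)) hz, wg_add _ _ s5 (s3.add s4) hz, wg_add _ _ s3 s4 hz,
    wg_mul _ _ (sm_pp hφ k) s1 hz, wg_add _ _ (sm_g hφ i j) ((sm_pp hφ i).mul (sm_qq hφ j)) hz,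
    wg_mul _ _ (sm_pp hφ i) (sm_qq hφ j) hz,
    wg_mul _ _ ((sm_pp hφ i).wg (-Complex.I) k) (sm_qq hφ j) hz,
    wg_mul _ _ (sm_pp hφ i) (sm_g hφ k j) hz, wd_pp_comm hφ _ _ hz, wd_pp_comm hφ _ _ hz,
    wdb_wd_pp hφ _ _ _ hz, wg_comm Complex.I (-Complex.I) l k (sm_g hφ i j) hz]
  change psi φ z * qq φ l z * _ + _ = _
  ring


lemma Km_sm (hφ : ContDiffOn ℝ (⊤ : ℕ∞) φ (Metric.ball 0 1)) (hdet : ∀ z ∈ BB n, (Gm φ z).det ≠ 0) : MSm (Km φ) := by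
  refine ((MSm_low fun i => (sm_pp hφ i).neg).T.mul (MSm_bd (sm_hh hφ) ?_)).mul
    (MSm_low fun i => (sm_qq hφ i).neg)
  intro a b
  have hG : MSm (Gm φ) := fun i j => sm_g hφ i j
  exact (sm_hh hφ).mul (hG.inv hdet b a)

lemma Lm_Km (hdet : ∀ z ∈ BB n, (Gm φ z).det ≠ 0) {z : EE n} (hz : z ∈ BB n) : Lm φ z * Km φ z = 1 := by
  have h1 : (low (fun i => pp φ i z))ᵀ * (low (fun i => - pp φ i z))ᵀ = 1 :=
    lowT_mul _ _ fun i => by ring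
  have h2 : low (fun i => qq φ i z) * low (fun i => - qq φ i z) = 1 :=
    low_mul _ _ fun i => by ring
  have h3 : bd (psi φ z) (psi φ z • (Gm φ z)ᵀ) * bd (hh φ z) (hh φ z • ginv (gmat φ) z) = 1 := by
    refine bd_mul _ _ _ _ (psi_hh z) ?_
    rw [Matrix.smul_mul, Matrix.mul_smul, smul_smul, psi_hh, one_smul]
    change (Gm φ z)ᵀ * ((Gm φ z)⁻¹)ᵀ = 1
    rw [← Matrix.transpose_mul, Matrix.nonsing_inv_mul _ (isUnit_iff_ne_zero.mpr (hdet z hz)),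
      Matrix.transpose_one]
  have : Lm φ z * Km φ z = low (fun i => qq φ i z) * (bd (psi φ z) (psi φ z • (Gm φ z)ᵀ) *
      ((low (fun i => pp φ i z))ᵀ * (low (fun i => - pp φ i z))ᵀ) *
      bd (hh φ z) (hh φ z • ginv (gmat φ) z)) * low (fun i => - qq φ i z) := by
    simp only [Lm, Km, Matrix.mul_assoc]
  rw [this, h1, Matrix.mul_one, h3, Matrix.mul_one, h2]

/-- The second fundamental expression for `L`. -/
lemma T_row0 (hφ : ContDiffOn ℝ (⊤ : ℕ∞) φ (Metric.ball 0 1)) (hdet : ∀ z ∈ BB n, (Gm φ z).det ≠ 0) (k l : Fin n) (b : Fin (n+1)) {z : EE n} (hz : z ∈ BB n) :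
    (mD Complex.I l (Lm φ) z * Km φ z * mD (-Complex.I) k (Lm φ) z
      - mD Complex.I l (mD (-Complex.I) k (Lm φ)) z) 0 b = 0 := by
  have hx : ∀ w ∈ BB n, ∀ c, mD Complex.I l (Lm φ) w 0 c = Lm φ w l.succ c := by
    intro w hw c
    refine Fin.cases ?_ (fun i => ?_) c
    · rw [wdb_L00 hφ l hw, Lm_s0]
    · rw [wdb_L0s hφ l i hw, Lm_ss]
  have e1 : (mD Complex.I l (Lm φ) z * Km φ z * mD (-Complex.I) k (Lm φ) z) 0 b
      = (Lm φ z * Km φ z * mD (-Complex.I) k (Lm φ) z) l.succ b := by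
    simp only [Matrix.mul_apply, hx z hz]
  rw [Matrix.sub_apply, e1, Lm_Km hdet hz, one_mul, sub_eq_zero]
  have : mD Complex.I l (mD (-Complex.I) k (Lm φ)) z 0 b
      = wg (-Complex.I) k (fun w => mD Complex.I l (Lm φ) w 0 b) z :=
    wg_comm _ _ _ _ (Lm_sm hφ 0 b) hz
  rw [this, wg_congr _ _ (fun w hw => hx w hw b) hz]
  rfl

lemma T_col0 (hφ : ContDiffOn ℝ (⊤ : ℕ∞) φ (Metric.ball 0 1)) (hdet : ∀ z ∈ BB n, (Gm φ z).det ≠ 0) (k l : Fin n) (a : Fin (n+1)) {z : EE n} (hz : z ∈ BB n) :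
    (mD Complex.I l (Lm φ) z * Km φ z * mD (-Complex.I) k (Lm φ) z
      - mD Complex.I l (mD (-Complex.I) k (Lm φ)) z) a 0 = 0 := by
  have hx : ∀ w ∈ BB n, ∀ c, mD (-Complex.I) k (Lm φ) w c 0 = Lm φ w c k.succ := by
    intro w hw c
    refine Fin.cases ?_ (fun i => ?_) c
    · rw [wd_L00 hφ k hw, Lm_0s]
    · rw [wd_Ls0 hφ k i hw, Lm_ss]
  have e1 : (mD Complex.I l (Lm φ) z * Km φ z * mD (-Complex.I) k (Lm φ) z) a 0
      = (mD Complex.I l (Lm φ) z * (Km φ z * Lm φ z)) a k.succ := by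
    rw [← Matrix.mul_assoc, Matrix.mul_apply, Matrix.mul_apply]
    simp only [hx z hz]
  rw [Matrix.sub_apply, e1, mul_eq_one_comm.mp (Lm_Km hdet hz), mul_one, sub_eq_zero]
  exact (wg_congr _ _ (fun w hw => hx w hw a) hz).symm

lemma T_ss (hφ : ContDiffOn ℝ (⊤ : ℕ∞) φ (Metric.ball 0 1)) (hdet : ∀ z ∈ BB n, (Gm φ z).det ≠ 0) (i j k l : Fin n) {z : EE n} (hz : z ∈ BB n) :
    (mD Complex.I l (Lm φ) z * Km φ z * mD (-Complex.I) k (Lm φ) z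
      - mD Complex.I l (mD (-Complex.I) k (Lm φ)) z) j.succ i.succ
    = psi φ z * (Riem (gmat φ) i j k l z
      - (gmat φ i j z * gmat φ k l z + gmat φ i l z * gmat φ k j z)) := by
  have hu := isUnit_iff_ne_zero.mpr (hdet z hz)
  have c1 : ∀ s j, ∑ r, ginv (gmat φ) z r s * gmat φ r j z = if s = j then 1 else 0 := by
    intro s j
    have := congrFun (congrFun (Matrix.nonsing_inv_mul _ hu) s) j
    rw [Matrix.mul_apply, Matrix.one_apply] at this
    exact this
  have c2 : ∀ r i, ∑ s, ginv (gmat φ) z r s * gmat φ i s z = if r = i then 1 else 0 := by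
    intro r i
    have := congrFun (congrFun (Matrix.mul_nonsing_inv _ hu) i) r
    rw [Matrix.mul_apply, Matrix.one_apply] at this
    simp only [eq_comm (a := r)]
    rw [← this]
    exact Finset.sum_congr rfl fun s _ => mul_comm _ _
  have hc := contraction (ginv (gmat φ) z) (fun i j => gmat φ i j z)
    (fun r => wg Complex.I l (gmat φ r j) z) (fun s => wg (-Complex.I) k (gmat φ i s) z)
    (qq φ j z) (qq φ l z) (pp φ k z) (pp φ i z) i j k l c1 c2
  have e : mD Complex.I l (Lm φ) z * Km φ z * mD (-Complex.I) k (Lm φ) z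
      = (mD Complex.I l (Lm φ) z * (low (fun i => - pp φ i z))ᵀ)
        * bd (hh φ z) (hh φ z • ginv (gmat φ) z)
        * (low (fun i => - qq φ i z) * mD (-Complex.I) k (Lm φ) z) := by
    simp only [Km, Matrix.mul_assoc]
  have hph : hh φ z * psi φ z = 1 := by rw [mul_comm]; exact psi_hh z
  have hs : ∀ r s : Fin n,
      (mD Complex.I l (Lm φ) z * (low (fun i => - pp φ i z))ᵀ) j.succ r.succ
        * (hh φ z • ginv (gmat φ) z) r s
        * (low (fun i => - qq φ i z) * mD (-Complex.I) k (Lm φ) z) s.succ i.succ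
      = psi φ z * ((wg Complex.I l (gmat φ r j) z + qq φ j z * gmat φ r l z + qq φ l z * gmat φ r j z)
        * ginv (gmat φ) z r s * (wg (-Complex.I) k (gmat φ i s) z + pp φ k z * gmat φ i s z
          + pp φ i z * gmat φ k s z)) := by
    intro r s
    rw [mul_lowT_s, low_mul_s, wdb_Lss hφ l r j hz, wdb_Ls0 hφ l j hz, wd_Lss hφ k i s hz,
      wd_L0s hφ k i hz, Matrix.smul_apply, smul_eq_mul]
    linear_combination (psi φ z * ((wg Complex.I l (gmat φ r j) z + qq φ j z * gmat φ r l z + qq φ l z * gmat φ r j z)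
        * ginv (gmat φ) z r s * (wg (-Complex.I) k (gmat φ i s) z + pp φ k z * gmat φ i s z
          + pp φ i z * gmat φ k s z))) * hph
  rw [Matrix.sub_apply, e, mul_bd_mul]
  simp only [hs, ← Finset.mul_sum]
  rw [hc, mul_lowT_0, low_mul_0, wdb_Ls0 hφ l j hz, wd_L0s hφ k i hz, wdb_wd_Lss hφ k l i j hz]
  simp only [Riem, wd_eq_wg, wdb_eq_wg]
  linear_combination (psi φ z * (qq φ l z * qq φ j z + wg Complex.I l (qq φ j) z) *
    (pp φ k z * pp φ i z + wg (-Complex.I) k (pp φ i) z)) * hph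

lemma Hmat_eq (hφ : ContDiffOn ℝ (⊤ : ℕ∞) φ (Metric.ball 0 1)) {z : EE n} (hz : z ∈ BB n) :
    (Matrix.of fun a b => Hmat (fun w => Real.exp (-(φ w))) (gmat φ) a b z)
      = low (fun i => z i) * Km φ z * (low (fun i => (starRingEnd ℂ) (z i)))ᵀ := by
  have hR : (fun w : EE n => ((Real.exp (-(φ w)) : ℝ) : ℂ)) = hh φ := by
    funext w; simp [hh, fC]
  have hne : hh φ z ≠ 0 := Complex.exp_ne_zero _
  have hw : ∀ p, (hh φ z)⁻¹ * wd p (hh φ) z = - pp φ p z := by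
    intro p
    rw [wd_eq_wg, wg_hh hφ _ _ hz]
    change (hh φ z)⁻¹ * -(hh φ z * pp φ p z) = _
    field_simp
  have e : low (fun i => z i) * Km φ z * (low (fun i => (starRingEnd ℂ) (z i)))ᵀ
      = (low (fun i => z i) * (low (fun i => - pp φ i z))ᵀ)
        * bd (hh φ z) (hh φ z • ginv (gmat φ) z)
        * (low (fun i => - qq φ i z) * (low (fun i => (starRingEnd ℂ) (z i)))ᵀ) := by
    simp only [Km, Matrix.mul_assoc]
  have l0 : ∀ a, low (fun i => z i) a 0 = uu a z := by
    intro a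
    refine Fin.cases ?_ (fun i => ?_) a
    · simp [uu_zero]
    · simp [uu_succ]
  have l0c : ∀ a, low (fun i => (starRingEnd ℂ) (z i)) a 0 = (starRingEnd ℂ) (uu a z) := by
    intro a
    refine Fin.cases ?_ (fun i => ?_) a
    · simp [uu_zero]
    · simp [uu_succ]
  have ls : ∀ a (p : Fin n), low (fun i => z i) a p.succ = wd p (uu a) z := by
    intro a p
    rw [wd_eq_wg]
    refine Fin.cases ?_ (fun i => ?_) a
    · rw [uu_zero, wg_const]; rfl
    · rw [uu_succ, wg_coord]
      simp
      norm_num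
  have lsc : ∀ a (p : Fin n), low (fun i => (starRingEnd ℂ) (z i)) a p.succ
      = (starRingEnd ℂ) (wd p (uu a) z) := by
    intro a p
    rw [← ls]
    refine Fin.cases ?_ (fun i => ?_) a
    · simp
    · simp [apply_ite (starRingEnd ℂ)]
  ext a b
  rw [e, mul_bd_mul]
  simp only [mul_lowT_0, low_mul_0, mul_lowT_s, low_mul_s, Matrix.transpose_apply, l0, l0c, ls, lsc,
    Matrix.of_apply, Hmat, hR]
  have hv : ((Real.exp (-(φ z)) : ℝ) : ℂ) = hh φ z := congrFun hR z
  simp only [hv, mul_assoc (uu _ z), hw, map_add, map_mul, map_neg, conj_pp hφ _ hz,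
    Finset.mul_sum, Matrix.smul_apply, smul_eq_mul]
  congr 1
  · ring
  · exact Finset.sum_congr rfl fun r _ => Finset.sum_congr rfl fun s _ => by ring

lemma FH_eq (hφ : ContDiffOn ℝ (⊤ : ℕ∞) φ (Metric.ball 0 1)) (hdet : ∀ z ∈ BB n, (Gm φ z).det ≠ 0) (k l : Fin n) {z : EE n} (hz : z ∈ BB n) :
    FH (fun w => Real.exp (-(φ w))) (gmat φ) k l z
      = low (fun i => z i) * Km φ z * (mD Complex.I l (Lm φ) z * Km φ z * mD (-Complex.I) k (Lm φ) z
        - mD Complex.I l (mD (-Complex.I) k (Lm φ)) z) * low (fun i => - z i) := by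
  rw [← curv_key (P := fun z => low (fun i => z i)) (Q := fun z => low (fun i => - z i))
    (R := fun z => (low (fun i => (starRingEnd ℂ) (z i)))ᵀ)
    (S := fun z => (low (fun i => - (starRingEnd ℂ) (z i)))ᵀ)
    (-Complex.I) Complex.I k l (MSm_low fun i => sm_coord i) (MSm_low fun i => (sm_coord i).neg)
    (MSm_low fun i => sm_coord_conj i).T (Km_sm hφ hdet) (Lm_sm hφ)
    (fun w _ => low_mul _ _ fun i => by ring) (fun w _ => lowT_mul _ _ fun i => by ring)
    (fun w hw => Lm_Km hdet hw)
    (fun w _ => mD_low _ _ fun i => by rw [wg_coord]; simp)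
    (fun w _ => by
      rw [mD_T, mD_low _ _ fun i => by rw [wg_coord_conj]; simp]
      simp) hz]
  have : FH (fun w => Real.exp (-(φ w))) (gmat φ) k l z = mD Complex.I l (fun w =>
      mD (-Complex.I) k (fun x => Matrix.of fun a b => Hmat (fun w => Real.exp (-(φ w))) (gmat φ) a b x) w
      * (Matrix.of fun a b => Hmat (fun w => Real.exp (-(φ w))) (gmat φ) a b w)⁻¹) z := by
    simp only [FH, wd_eq_wg, wdb_eq_wg]
    rfl
  rw [this]
  refine mD_congr _ _ (fun w hw => ?_) hz
  rw [Hmat_eq hφ hw, mD_congr _ _ (fun x hx => Hmat_eq hφ hx) hw]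

lemma FH_zero_iff (hφ : ContDiffOn ℝ (⊤ : ℕ∞) φ (Metric.ball 0 1)) (hdet : ∀ z ∈ BB n, (Gm φ z).det ≠ 0) (k l : Fin n) {z : EE n} (hz : z ∈ BB n) :
    FH (fun w => Real.exp (-(φ w))) (gmat φ) k l z = 0 ↔ ∀ i j : Fin n,
      Riem (gmat φ) i j k l z = gmat φ i j z * gmat φ k l z + gmat φ i l z * gmat φ k j z := by
  have hne : psi φ z ≠ 0 := Complex.exp_ne_zero _
  rw [FH_eq hφ hdet k l hz]
  have t00 := fun b => T_row0 hφ hdet k l b hz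
  have t0 := fun a => T_col0 hφ hdet k l a hz
  have ts := fun i j => T_ss hφ hdet i j k l hz
  have hLK := Lm_Km hdet hz
  have hPQ : low (fun i => - z i) * low (fun i => z i) = 1 := low_mul _ _ fun i => by ring
  have hQP : low (fun i => z i) * low (fun i => - z i) = 1 := low_mul _ _ fun i => by ring
  set T := mD Complex.I l (Lm φ) z * Km φ z * mD (-Complex.I) k (Lm φ) z
        - mD Complex.I l (mD (-Complex.I) k (Lm φ)) z with hT
  constructor
  · intro h i j
    have : T = 0 := by
      calc T = (Lm φ z * ((low (fun i => - z i) * low (fun i => z i)) * Km φ z)) * T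
            * (low (fun i => - z i) * low (fun i => z i)) := by
            rw [hPQ, one_mul, hLK, one_mul, mul_one]
        _ = Lm φ z * low (fun i => - z i) * (low (fun i => z i) * Km φ z * T * low (fun i => - z i))
            * low (fun i => z i) := by simp only [Matrix.mul_assoc]
        _ = 0 := by rw [h]; simp
    have e := ts i j
    rw [this, Matrix.zero_apply] at e
    exact sub_eq_zero.mp ((mul_eq_zero.mp e.symm).resolve_left hne)
  · intro h
    have : T = 0 := by
      ext a b
      refine Fin.cases ?_ (fun j => ?_) a
      · exact t00 b
      · refine Fin.cases ?_ (fun i => ?_) b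
        · exact t0 _
        · rw [ts i j, h i j, sub_self, mul_zero]; rfl
    rw [this]; simp

end main

/-- The Hermitian matrix `H` built from `h = exp(−φ)` on the unit ball
is flat if and only if `g` has constant holomorphic sectional curvature `κ = 2`. -/
theorem H_flat_iff_chsc_two (n : ℕ) (φ : EuclideanSpace ℂ (Fin n) → ℝ)
    (hφ : ContDiffOn ℝ (⊤ : ℕ∞) φ (Metric.ball 0 1))
    (hpos : ∀ z ∈ Metric.ball (0 : EuclideanSpace ℂ (Fin n)) 1,
      (Matrix.of fun i j => gmat φ i j z).PosDef) :
    (∀ z ∈ Metric.ball (0 : EuclideanSpace ℂ (Fin n)) 1, ∀ k l : Fin n,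
        FH (fun w => Real.exp (-(φ w))) (gmat φ) k l z = 0)
      ↔ (∀ z ∈ Metric.ball (0 : EuclideanSpace ℂ (Fin n)) 1, ∀ i j k l : Fin n,
          Riem (gmat φ) i j k l z
            = gmat φ i j z * gmat φ k l z + gmat φ i l z * gmat φ k j z) := by
  have hdet : ∀ z ∈ BB n, (Gm φ z).det ≠ 0 := fun z hz => ne_of_gt (hpos z hz).det_pos
  constructor
  · intro h z hz i j k l
    exact (FH_zero_iff hφ hdet k l hz).mp (h z hz k l) i j
  · intro h z hz k l
    exact (FH_zero_iff hφ hdet k l hz).mpr fun i j => h z hz i j k l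
end
end

section
/- In the normalized local setup at the origin, all first-order Wirtinger derivatives of the matrix H vanish at the origin: ∂_k H^{ab̄}(0) = 0 and ∂_k̄ H^{ab̄}(0) = 0 for all 0 ≤ a,b ≤ n and 1 ≤ k ≤ n, where H^{ab̄} = h u_a conj(u_b) + h g^{pq̄}(∂_p u_a + u_a h^{-1}∂_p h)·conj(∂_q u_b + u_b h^{-1}∂_q h), with u_0 = 1 and u_i = z^i. -/
noncomputable section
open Complex Matrix
open scoped ComplexOrder

/-- Unified Wirtinger-type operator. -/
def WW {n : ℕ} (s : ℂ) (k : Fin n) (f : EuclideanSpace ℂ (Fin n) → ℂ)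
    (z : EuclideanSpace ℂ (Fin n)) : ℂ :=
  (1/2 : ℂ) * (fderiv ℝ f z (EuclideanSpace.single k 1)
    + s * fderiv ℝ f z (EuclideanSpace.single k Complex.I))

lemma wd_eq_WW {n : ℕ} (k : Fin n) (f : EuclideanSpace ℂ (Fin n) → ℂ) :
    wd k f = WW (-Complex.I) k f := by
  funext z; simp only [wd, WW]; ring

lemma wdb_eq_WW {n : ℕ} (k : Fin n) (f : EuclideanSpace ℂ (Fin n) → ℂ) :
    wdb k f = WW (Complex.I) k f := rfl

/-- `f` is real-differentiable at `z` and its `WW s k` derivative is `d`. -/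
def HasW {n : ℕ} (s : ℂ) (k : Fin n) (f : EuclideanSpace ℂ (Fin n) → ℂ)
    (z : EuclideanSpace ℂ (Fin n)) (d : ℂ) : Prop :=
  DifferentiableAt ℝ f z ∧ WW s k f z = d

section rules
variable {n : ℕ} {s : ℂ} {k : Fin n} {f f' : EuclideanSpace ℂ (Fin n) → ℂ}
  {z : EuclideanSpace ℂ (Fin n)} {d d' : ℂ}

lemma HasW.const (c : ℂ) : HasW s k (fun _ => c) z 0 := by
  refine ⟨by fun_prop, ?_⟩
  simp [WW]

lemma HasW.add (hf : HasW s k f z d) (hf' : HasW s k f' z d') :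
    HasW s k (fun w => f w + f' w) z (d + d') := by
  refine ⟨hf.1.add hf'.1, ?_⟩
  rw [← hf.2, ← hf'.2]
  simp only [WW]
  rw [fderiv_fun_add hf.1 hf'.1]
  simp only [_root_.add_apply]
  ring

lemma HasW.mul (hf : HasW s k f z d) (hf' : HasW s k f' z d') :
    HasW s k (fun w => f w * f' w) z (d * f' z + f z * d') := by
  refine ⟨hf.1.mul hf'.1, ?_⟩
  rw [← hf.2, ← hf'.2]
  simp only [WW]
  rw [fderiv_fun_mul hf.1 hf'.1]
  simp only [_root_.add_apply, _root_.smul_apply, smul_eq_mul]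
  ring

lemma HasW.sum {ι : Type*} (t : Finset ι) {F : ι → EuclideanSpace ℂ (Fin n) → ℂ} {D : ι → ℂ}
    (hF : ∀ i, HasW s k (F i) z (D i)) :
    HasW s k (fun w => ∑ i ∈ t, F i w) z (∑ i ∈ t, D i) := by
  classical
  induction t using Finset.induction_on with
  | empty => simpa using HasW.const (s := s) (k := k) (z := z) 0
  | insert a t ha ih =>
    simp only [Finset.sum_insert ha]
    exact (hF a).add ih

lemma HasW.conj (hf : HasW ((starRingEnd ℂ) s) k f z d) :
    HasW s k (fun w => (starRingEnd ℂ) (f w)) z ((starRingEnd ℂ) d) := by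
  have h1 : HasFDerivAt (fun w => (starRingEnd ℂ) (f w))
      ((Complex.conjCLE : ℂ →L[ℝ] ℂ).comp (fderiv ℝ f z)) z :=
    (Complex.conjCLE : ℂ →L[ℝ] ℂ).hasFDerivAt.comp z hf.1.hasFDerivAt
  refine ⟨h1.differentiableAt, ?_⟩
  rw [← hf.2]
  simp only [WW]
  rw [h1.fderiv]
  have h2 : (starRingEnd ℂ) (2 : ℂ) = 2 := Complex.conj_ofNat 2
  simp [h2]

lemma HasW.congr (hf : HasW s k f z d) (e : f' =ᶠ[nhds z] f) : HasW s k f' z d := by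
  refine ⟨hf.1.congr_of_eventuallyEq e, ?_⟩
  rw [← hf.2]
  simp only [WW]
  rw [e.fderiv_eq]

lemma WW_contDiffOn {Ω : Set (EuclideanSpace ℂ (Fin n))} (hΩ : IsOpen Ω)
    (hf : ContDiffOn ℝ (⊤ : ℕ∞) f Ω) : ContDiffOn ℝ (⊤ : ℕ∞) (WW s k f) Ω := by
  have h1 : ContDiffOn ℝ (⊤ : ℕ∞) (fderiv ℝ f) Ω := hf.fderiv_of_isOpen hΩ (by simp)
  have h2 : ∀ v, ContDiffOn ℝ (⊤ : ℕ∞) (fun z => fderiv ℝ f z v) Ω := fun v =>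
    h1.clm_apply contDiffOn_const
  exact contDiffOn_const.mul ((h2 _).add (contDiffOn_const.mul (h2 _)))

lemma diffAt_of {Ω : Set (EuclideanSpace ℂ (Fin n))} (hΩ : IsOpen Ω) (hz : z ∈ Ω)
    (hf : ContDiffOn ℝ (⊤ : ℕ∞) f Ω) : DifferentiableAt ℝ f z :=
  (hf.contDiffAt (hΩ.mem_nhds hz)).differentiableAt (by simp)

/-- the values of `∂_p u_a` -/
def dl (a : Fin (n + 1)) (p : Fin n) : ℂ := if a = p.succ then 1 else 0

lemma uu_hasW (a : Fin (n + 1)) :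
    HasW s k (uu a) z ((1/2 : ℂ) * (1 + s * Complex.I) * dl a k) := by
  refine Fin.cases ?_ (fun i => ?_) a
  · have : (uu (0 : Fin (n+1))) = fun _ : EuclideanSpace ℂ (Fin n) => (1:ℂ) := by
      funext z; simp [uu]
    rw [this]
    simpa [dl, (Fin.succ_ne_zero _).symm] using HasW.const (s := s) (k := k) (z := z) 1
  · have : (uu i.succ) = ((EuclideanSpace.proj i : EuclideanSpace ℂ (Fin n) →L[ℂ] ℂ).restrictScalars ℝ) := by
      funext z; simp [uu]
    rw [this]
    refine ⟨ContinuousLinearMap.differentiableAt _, ?_⟩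
    simp only [WW, ContinuousLinearMap.fderiv]
    by_cases hik : i = k
    · subst hik; simp [dl]
    · simp [dl, hik]

lemma wd_uu (a : Fin (n + 1)) (p : Fin n) : wd p (uu a) z = dl a p := by
  rw [wd_eq_WW, uu_hasW a |>.2]; simp; ring

lemma uu_zero_s7 (a : Fin (n + 1)) :
    uu a (0 : EuclideanSpace ℂ (Fin n)) = if a = 0 then 1 else 0 := by
  by_cases h : a = 0 <;> simp [uu, h]

lemma ginv_diff {g : Fin n → Fin n → EuclideanSpace ℂ (Fin n) → ℂ}
    (hg : ∀ i j, DifferentiableAt ℝ (g i j) z)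
    (hdet : (Matrix.of fun i j => g i j z).det ≠ 0) (p q : Fin n) :
    DifferentiableAt ℝ (fun w => ginv g w p q) z := by
  have hd : ∀ G : Fin n → Fin n → EuclideanSpace ℂ (Fin n) → ℂ,
      (∀ i j, DifferentiableAt ℝ (G i j) z) →
      DifferentiableAt ℝ (fun w => (Matrix.of fun i j => G i j w).det) z := by
    intro G hG
    simp only [Matrix.det_apply', Matrix.of_apply]
    refine DifferentiableAt.fun_sum fun σ _ => ?_
    refine (differentiableAt_const _).mul ?_
    have hp : ∀ t : Finset (Fin n), DifferentiableAt ℝ (fun w => ∏ i ∈ t, G (σ i) i w) z := by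
      intro t
      induction t using Finset.induction_on with
      | empty => simp
      | insert i t hi ih =>
        simp only [Finset.prod_insert hi]
        exact (hG _ _).mul ih
    exact hp _
  simp only [ginv, Matrix.transpose_apply, Matrix.inv_def, Ring.inverse_eq_inv', Matrix.smul_apply,
    smul_eq_mul, Matrix.adjugate_apply]
  refine ((hd g hg).inv hdet).mul ?_
  have := hd (fun i j w => (Matrix.updateRow (Matrix.of fun i j => g i j w) p (Pi.single q 1)) i j) ?_
  · exact this
  · intro i j
    by_cases hi : i = p
    · subst hi; simp
    · simpa [Matrix.updateRow_apply, hi] using hg i j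

lemma ginv_hasW {g : Fin n → Fin n → EuclideanSpace ℂ (Fin n) → ℂ}
    (hg : ∀ i j, HasW s k (g i j) z 0)
    (h1 : ∀ i j, g i j z = if i = j then 1 else 0) 
    (hdet : ∀ᶠ w in nhds z, (Matrix.of fun i j => g i j w).det ≠ 0) (p q : Fin n) :
    HasW s k (fun w => ginv g w p q) z 0 := by
  have hdiff := ginv_diff (fun i j => (hg i j).1) hdet.self_of_nhds
  refine ⟨hdiff p q, ?_⟩
  have key : HasW s k (fun w => ∑ j, g q j w * ginv g w p j) z
      (∑ j, (0 * ginv g z p j + g q j z * WW s k (fun w => ginv g w p j) z)) :=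
    HasW.sum _ fun j => (hg q j).mul ⟨hdiff p j, rfl⟩
  have e : (fun w => ∑ j, g q j w * ginv g w p j) =ᶠ[nhds z]
      fun _ => if q = p then 1 else 0 := by
    filter_upwards [hdet] with w hw
    have := congrFun₂ (Matrix.mul_nonsing_inv (Matrix.of fun i j => g i j w) (isUnit_iff_ne_zero.2 hw)) q p
    simpa [Matrix.mul_apply, ginv, Matrix.one_apply] using this
  have := key.2.symm.trans ((HasW.const (s := s) (k := k) (z := z) _).congr e).2
  simpa [h1] using this

lemma ginv_at {g : Fin n → Fin n → EuclideanSpace ℂ (Fin n) → ℂ}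
    (h1 : ∀ i j, g i j z = if i = j then 1 else 0) (p q : Fin n) :
    ginv g z p q = if p = q then 1 else 0 := by
  have : (Matrix.of fun i j => g i j z) = 1 := by
    ext i j; simp [h1, Matrix.one_apply]
  simp [ginv, this, Matrix.one_apply, eq_comm]

lemma Hmat_hasW (h : EuclideanSpace ℂ (Fin n) → ℝ)
    {g : Fin n → Fin n → EuclideanSpace ℂ (Fin n) → ℂ}
    (hg : ∀ p q, HasW s k (fun w => ginv g w p q) 0 0)
    (h1 : ∀ i j, g i j 0 = if i = j then 1 else 0)
    (hh0 : h 0 = 1)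
    (hW : ∀ s, HasW s k (fun w => (h w : ℂ)) 0 0)
    (hWi : ∀ s, HasW s k (fun w => (h w : ℂ)⁻¹) 0 0)
    (hd0 : ∀ p, wd p (fun w => (h w : ℂ)) 0 = 0)
    (m m' : Fin n → ℂ)
    (hm : ∀ p, HasW s k (wd p (fun w => (h w : ℂ))) 0 (m p))
    (hm' : ∀ p, HasW ((starRingEnd ℂ) s) k (wd p (fun w => (h w : ℂ))) 0 (m' p))
    (a b : Fin (n + 1)) :
    WW s k (Hmat h g a b) 0 =
      (1/2 : ℂ) * (1 + s * Complex.I) * dl a k * (if b = 0 then 1 else 0)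
      + (if a = 0 then 1 else 0) * ((1/2 : ℂ) * (1 - s * Complex.I) * dl b k)
      + ∑ p, ((if a = 0 then 1 else 0) * m p * dl b p
          + dl a p * ((if b = 0 then 1 else 0) * (starRingEnd ℂ) (m' p))) := by
  have hA := fun p => (HasW.const (s := s) (k := k) (z := 0) (dl a p)).add
    (((uu_hasW (s := s) (k := k) (z := 0) a).mul (hWi s)).mul (hm p))
  have hB := fun q => HasW.conj ((HasW.const (s := (starRingEnd ℂ) s) (k := k) (z := 0)
    (dl b q)).add (((uu_hasW (s := (starRingEnd ℂ) s) (k := k) (z := 0) b).mul (hWi _)).mul (hm' q)))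
  have hS := HasW.sum Finset.univ fun p => HasW.sum Finset.univ fun q =>
    ((hg p q).mul (hA p)).mul (hB q)
  have hT := (((hW s).mul (uu_hasW a)).mul (HasW.conj (uu_hasW b))).add ((hW s).mul hS)
  have hT2 := (hT.congr (f' := Hmat h g a b) (Filter.EventuallyEq.of_eq (by
    funext w
    simp only [Hmat, wd_uu]))).2
  rw [hT2]
  have hdl : ∀ b q, (starRingEnd ℂ) (dl (n := n) b q) = dl b q := by
    intro b q; unfold dl; split_ifs <;> simp
  simp only [ginv_at h1, hd0, hh0, uu_zero_s7, hdl, map_add, map_mul]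
  have h2 : (starRingEnd ℂ) (2 : ℂ) = 2 := Complex.conj_ofNat 2
  by_cases ha : a = 0 <;> by_cases hb : b = 0 <;>
    simp [ha, hb, h2, Finset.sum_add_distrib] <;> left <;> ring
end rules

/-- In the normalized local setup at the origin, all first-order
Wirtinger derivatives of the matrix `H^{ab̄}` vanish at the origin. -/
theorem dHmat_eq_zero_at_origin
    (n : ℕ) (Ω : Set (EuclideanSpace ℂ (Fin n)))
    (hΩ : IsOpen Ω) (h0Ω : (0 : EuclideanSpace ℂ (Fin n)) ∈ Ω)
    -- `g_{ij̄} = ∂_i∂_j̄ φ` is positive definite on the neighborhood `Ω` of `0`: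
    (φ : EuclideanSpace ℂ (Fin n) → ℝ) (hφ : ContDiffOn ℝ (⊤ : ℕ∞) φ Ω)
    (g : Fin n → Fin n → EuclideanSpace ℂ (Fin n) → ℂ)
    (hgφ : ∀ i j : Fin n, ∀ z ∈ Ω, g i j z = wd i (wdb j (fun w => (φ w : ℂ))) z)
    (hposdef : ∀ z ∈ Ω, (Matrix.of fun i j => g i j z).PosDef)
    -- normalization of `g` at the origin:
    (hg0 : ∀ i j : Fin n, g i j 0 = if i = j then 1 else 0)
    (hdg0 : ∀ i j k : Fin n, wd k (g i j) 0 = 0 ∧ wdb k (g i j) 0 = 0)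
    -- `h` is a smooth positive function with `g = −∂∂̄ log h`, normalized at the origin:
    (h : EuclideanSpace ℂ (Fin n) → ℝ) (hsm : ContDiffOn ℝ (⊤ : ℕ∞) h Ω)
    (hpos : ∀ z ∈ Ω, 0 < h z)
    (hgh : ∀ i j : Fin n, ∀ z ∈ Ω,
      g i j z = -wd i (wdb j (fun w => (Real.log (h w) : ℂ))) z)
    (hh0 : h 0 = 1) (hdh0 : fderiv ℝ h 0 = 0)
    (hh2 : ∀ i j : Fin n, wd i (wd j (fun w => (h w : ℂ))) 0 = 0
      ∧ wdb i (wdb j (fun w => (h w : ℂ))) 0 = 0)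
    :
    ∀ (a b : Fin (n + 1)) (k : Fin n),
      wd k (Hmat h g a b) 0 = 0 ∧ wdb k (Hmat h g a b) 0 = 0 := by
  intro a b k
  have hnh : Ω ∈ nhds (0 : EuclideanSpace ℂ (Fin n)) := hΩ.mem_nhds h0Ω
  have ofR : ∀ f : EuclideanSpace ℂ (Fin n) → ℝ, ContDiffOn ℝ (⊤ : ℕ∞) f Ω →
      ContDiffOn ℝ (⊤ : ℕ∞) (fun w => (f w : ℂ)) Ω := fun f hf =>
    Complex.ofRealCLM.contDiff.comp_contDiffOn hf
  have hhC := ofR h hsm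
  have hgdiff : ∀ i j, DifferentiableAt ℝ (g i j) 0 := by
    intro i j
    refine diffAt_of hΩ h0Ω (ContDiffOn.congr ?_ (hgφ i j))
    rw [wd_eq_WW, wdb_eq_WW]
    exact WW_contDiffOn hΩ (WW_contDiffOn hΩ (ofR φ hφ))
  have hdet : ∀ᶠ w in nhds (0 : EuclideanSpace ℂ (Fin n)),
      (Matrix.of fun i j => g i j w).det ≠ 0 := by
    filter_upwards [hnh] with w hw
    exact (hposdef w hw).det_pos.ne'
  have hhd : DifferentiableAt ℝ h 0 :=
    (hsm.contDiffAt hnh).differentiableAt (by simp)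
  have hfd : HasFDerivAt (fun w => (h w : ℂ)) (0 : EuclideanSpace ℂ (Fin n) →L[ℝ] ℂ) 0 := by
    have h1 := hhd.hasFDerivAt
    rw [hdh0] at h1
    have h2 := Complex.ofRealCLM.hasFDerivAt.comp 0 h1
    rw [ContinuousLinearMap.comp_zero] at h2
    exact h2
  have hW : ∀ (s : ℂ) (k : Fin n), HasW s k (fun w => (h w : ℂ)) 0 0 := by
    intro s k
    refine ⟨hfd.differentiableAt, ?_⟩
    simp [WW, hfd.fderiv]
  have hne : ∀ z ∈ Ω, (h z : ℂ) ≠ 0 := fun z hz => by exact_mod_cast (hpos z hz).ne'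
  have hWi : ∀ (s : ℂ) (k : Fin n), HasW s k (fun w => (h w : ℂ)⁻¹) 0 0 := by
    intro s k
    have hd : DifferentiableAt ℝ (fun w => (h w : ℂ)⁻¹) 0 :=
      hfd.differentiableAt.inv (hne 0 h0Ω)
    refine ⟨hd, ?_⟩
    have h1 := ((hW s k).mul ⟨hd, rfl⟩).2
    have e : (fun w => (h w : ℂ) * (h w : ℂ)⁻¹) =ᶠ[nhds 0] fun _ => 1 := by
      filter_upwards [hnh] with w hw
      exact mul_inv_cancel₀ (hne w hw)
    have h2 := h1.symm.trans ((HasW.const (s := s) (k := k) (z := 0) 1).congr e).2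
    simpa [hh0] using h2
  have hWd : ∀ (s t : ℂ) (k p : Fin n), HasW s k (WW t p (fun w => (h w : ℂ))) 0
      (WW s k (WW t p (fun w => (h w : ℂ))) 0) := fun s t k p =>
    ⟨diffAt_of hΩ h0Ω (WW_contDiffOn hΩ hhC), rfl⟩
  -- mixed second derivatives
  have hmix : ∀ i j : Fin n, WW (-Complex.I) i (WW Complex.I j (fun w => (h w : ℂ))) 0
      = if i = j then -1 else 0 := by
    intro i j
    have e : wdb j (fun w => (Real.log (h w) : ℂ)) =ᶠ[nhds 0]
        fun w => (h w : ℂ)⁻¹ * WW Complex.I j (fun w => (h w : ℂ)) w := by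
      filter_upwards [hnh] with w hw
      have hd : HasFDerivAt h (fderiv ℝ h w) w :=
        ((hsm.contDiffAt (hΩ.mem_nhds hw)).differentiableAt (by simp)).hasFDerivAt
      have d1 := Complex.ofRealCLM.hasFDerivAt.comp w hd
      have d2 := Complex.ofRealCLM.hasFDerivAt.comp w (hd.log (hpos w hw).ne')
      have f1 : fderiv ℝ (fun w => (h w : ℂ)) w = _ := d1.fderiv
      have f2 : fderiv ℝ (fun w => (Real.log (h w) : ℂ)) w = _ := d2.fderiv
      simp only [wdb, WW, f1, f2]
      simp
      ring
    have h1 := (((hWi (-Complex.I) i).mul (hWd (-Complex.I) Complex.I i j)).congr e).2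
    have h2 := hgh i j 0 h0Ω
    rw [wd_eq_WW, h1, hg0, hh0] at h2
    have h3 : WW (-Complex.I) i (WW Complex.I j (fun w => (h w : ℂ))) 0
      = -(if i = j then 1 else 0) := by
      rw [h2]; simp
    rw [h3]; split_ifs <;> simp
  have hconj : ∀ p : Fin n, (WW (-Complex.I) p (fun w => (h w : ℂ))) =ᶠ[nhds 0]
      fun w => (starRingEnd ℂ) (WW Complex.I p (fun w => (h w : ℂ)) w) := by
    intro p
    filter_upwards [hnh] with w hw
    have h1 : HasW ((starRingEnd ℂ) (-Complex.I)) p (fun w => (h w : ℂ)) w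
        (WW Complex.I p (fun w => (h w : ℂ)) w) :=
      ⟨diffAt_of hΩ hw hhC, by simp⟩
    simpa using h1.conj.2
  have hmI : ∀ p : Fin n, HasW Complex.I k (wd p (fun w => (h w : ℂ))) 0
      (if k = p then -1 else 0) := by
    intro p
    rw [wd_eq_WW]
    have h1 : HasW ((starRingEnd ℂ) Complex.I) k (WW Complex.I p (fun w => (h w : ℂ))) 0
        (if k = p then -1 else 0) := by
      rw [Complex.conj_I, ← hmix k p]
      exact hWd _ _ _ _
    have h2 := h1.conj.congr (hconj p)
    have h3 : (starRingEnd ℂ) (if k = p then (-1 : ℂ) else 0) = if k = p then -1 else 0 := by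
      split_ifs <;> simp
    rwa [h3] at h2
  have hmn : ∀ p : Fin n, HasW (-Complex.I) k (wd p (fun w => (h w : ℂ))) 0 0 := by
    intro p
    have h1 := (hh2 k p).1
    rw [wd_eq_WW, wd_eq_WW] at h1
    rw [wd_eq_WW]
    exact ⟨(hWd 0 _ k p).1, h1⟩
  have hd0 : ∀ p : Fin n, wd p (fun w => (h w : ℂ)) 0 = 0 := by
    intro p; rw [wd_eq_WW]; exact (hW _ p).2
  constructor
  · have hg : ∀ i j, HasW (-Complex.I) k (g i j) 0 0 := fun i j =>
      ⟨hgdiff i j, by rw [← wd_eq_WW]; exact (hdg0 i j k).1⟩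
    rw [wd_eq_WW, Hmat_hasW h (ginv_hasW hg hg0 hdet) hg0 hh0 (fun s => hW s k)
      (fun s => hWi s k) hd0 _ _ hmn (by simpa using hmI) a b]
    refine Fin.cases ?_ (fun i => ?_) a <;> refine Fin.cases ?_ (fun j => ?_) b <;>
      simp [dl, Fin.succ_ne_zero, (Fin.succ_ne_zero _).symm]
    by_cases hk : i = k
    · subst hk; norm_num
    · simp [hk, Ne.symm hk]
  · have hg : ∀ i j, HasW Complex.I k (g i j) 0 0 := fun i j =>
      ⟨hgdiff i j, by rw [← wdb_eq_WW]; exact (hdg0 i j k).2⟩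
    rw [wdb_eq_WW, Hmat_hasW h (ginv_hasW hg hg0 hdet) hg0 hh0 (fun s => hW s k)
      (fun s => hWi s k) hd0 _ _ hmI (by simpa using hmn) a b]
    refine Fin.cases ?_ (fun i => ?_) a <;> refine Fin.cases ?_ (fun j => ?_) b <;>
      simp [dl, Fin.succ_ne_zero, (Fin.succ_ne_zero _).symm]
    by_cases hk : j = k
    · subst hk; norm_num
    · simp [hk, Ne.symm hk]
end
end

section
/- In the normalized local setup at the origin, for the matrix H^{ab̄} = h u_a conj(u_b) + h g^{pq̄}(∂_p u_a + u_a h^{-1}∂_p h)·conj(∂_q u_b + u_b h^{-1}∂_q h) (u_0 = 1, u_i = z^i), one has (∂_k ∂_l̄ H^{ij̄})(0) = (∂_k ∂_l̄ g^{ij̄})(0) − (δ^{ij} δ_{kl} + δ^i_k δ^j_l) for all 1 ≤ i,j,k,l ≤ n. -/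
noncomputable section
open Complex Matrix
open scoped ComplexOrder

namespace JetAux

variable {n : ℕ}


lemma wd_congr {k : Fin n} {f f' : (EuclideanSpace ℂ (Fin n)) → ℂ} {z : EuclideanSpace ℂ (Fin n)} (hf : f =ᶠ[nhds z] f') :
    wd k f z = wd k f' z := by
  unfold wd; rw [hf.fderiv_eq]

lemma wdb_congr {k : Fin n} {f f' : (EuclideanSpace ℂ (Fin n)) → ℂ} {z : EuclideanSpace ℂ (Fin n)} (hf : f =ᶠ[nhds z] f') :
    wdb k f z = wdb k f' z := by
  unfold wdb; rw [hf.fderiv_eq]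

lemma wdb_congr_ev {k : Fin n} {f f' : (EuclideanSpace ℂ (Fin n)) → ℂ} {z : EuclideanSpace ℂ (Fin n)} (hf : f =ᶠ[nhds z] f') :
    wdb k f =ᶠ[nhds z] wdb k f' := by
  filter_upwards [hf.eventuallyEq_nhds] with w hw using wdb_congr hw

lemma wd_add {k : Fin n} {f f' : (EuclideanSpace ℂ (Fin n)) → ℂ} {z : EuclideanSpace ℂ (Fin n)} (hf : DifferentiableAt ℝ f z)
    (hf' : DifferentiableAt ℝ f' z) :
    wd k (fun w => f w + f' w) z = wd k f z + wd k f' z := by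
  unfold wd; rw [fderiv_fun_add hf hf']; simp; ring

lemma wdb_add {k : Fin n} {f f' : (EuclideanSpace ℂ (Fin n)) → ℂ} {z : EuclideanSpace ℂ (Fin n)} (hf : DifferentiableAt ℝ f z)
    (hf' : DifferentiableAt ℝ f' z) :
    wdb k (fun w => f w + f' w) z = wdb k f z + wdb k f' z := by
  unfold wdb; rw [fderiv_fun_add hf hf']; simp; ring

lemma wd_mul {k : Fin n} {f f' : (EuclideanSpace ℂ (Fin n)) → ℂ} {z : EuclideanSpace ℂ (Fin n)} (hf : DifferentiableAt ℝ f z)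
    (hf' : DifferentiableAt ℝ f' z) :
    wd k (fun w => f w * f' w) z = wd k f z * f' z + f z * wd k f' z := by
  unfold wd; rw [fderiv_fun_mul hf hf']; simp; ring

lemma wdb_mul {k : Fin n} {f f' : (EuclideanSpace ℂ (Fin n)) → ℂ} {z : EuclideanSpace ℂ (Fin n)} (hf : DifferentiableAt ℝ f z)
    (hf' : DifferentiableAt ℝ f' z) :
    wdb k (fun w => f w * f' w) z = wdb k f z * f' z + f z * wdb k f' z := by
  unfold wdb; rw [fderiv_fun_mul hf hf']; simp; ring

lemma wd_const {k : Fin n} (c : ℂ) : wd k (fun _ : EuclideanSpace ℂ (Fin n) => c) = fun _ => 0 := by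
  funext z; simp [wd]

lemma wdb_const {k : Fin n} (c : ℂ) : wdb k (fun _ : EuclideanSpace ℂ (Fin n) => c) = fun _ => 0 := by
  funext z; simp [wdb]

lemma wd_coord (k i : Fin n) :
    wd k (fun z : EuclideanSpace ℂ (Fin n) => z i) = fun _ => if i = k then 1 else 0 := by
  funext z
  have : HasFDerivAt (fun z : EuclideanSpace ℂ (Fin n) => z i)
    ((EuclideanSpace.proj i : (EuclideanSpace ℂ (Fin n)) →L[ℂ] ℂ).restrictScalars ℝ) z :=
    ((EuclideanSpace.proj i : (EuclideanSpace ℂ (Fin n)) →L[ℂ] ℂ).restrictScalars ℝ).hasFDerivAt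
  unfold wd; rw [this.fderiv]
  by_cases hik : i = k
  · subst hik; simp; norm_num
  · simp [hik]

lemma wdb_coord (k i : Fin n) : wdb k (fun z : EuclideanSpace ℂ (Fin n) => z i) = fun _ => 0 := by
  funext z
  have : HasFDerivAt (fun z : EuclideanSpace ℂ (Fin n) => z i)
    ((EuclideanSpace.proj i : (EuclideanSpace ℂ (Fin n)) →L[ℂ] ℂ).restrictScalars ℝ) z :=
    ((EuclideanSpace.proj i : (EuclideanSpace ℂ (Fin n)) →L[ℂ] ℂ).restrictScalars ℝ).hasFDerivAt
  unfold wdb; rw [this.fderiv]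
  by_cases hik : i = k
  · subst hik; simp
  · simp [hik]

lemma fderiv_conj (f : (EuclideanSpace ℂ (Fin n)) → ℂ) (z v : EuclideanSpace ℂ (Fin n)) :
    fderiv ℝ (fun w => (starRingEnd ℂ) (f w)) z v = (starRingEnd ℂ) (fderiv ℝ f z v) := by
  have := (Complex.conjCLE : ℂ ≃L[ℝ] ℂ).comp_fderiv (f := f) (x := z)
  have h2 : (fun w => (starRingEnd ℂ) (f w)) = Complex.conjCLE ∘ f := by
    funext w; simp
  rw [h2, this]; simp

lemma wd_conj {k : Fin n} (f : (EuclideanSpace ℂ (Fin n)) → ℂ) (z : EuclideanSpace ℂ (Fin n)) :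
    wd k (fun w => (starRingEnd ℂ) (f w)) z = (starRingEnd ℂ) (wdb k f z) := by
  unfold wd wdb; rw [fderiv_conj, fderiv_conj]; simp [sub_eq_add_neg, Complex.conj_ofNat]

lemma wdb_conj {k : Fin n} (f : (EuclideanSpace ℂ (Fin n)) → ℂ) (z : EuclideanSpace ℂ (Fin n)) :
    wdb k (fun w => (starRingEnd ℂ) (f w)) z = (starRingEnd ℂ) (wd k f z) := by
  unfold wd wdb; rw [fderiv_conj, fderiv_conj]; simp [Complex.conj_ofNat]

lemma contDiffAt_wd {k : Fin n} {f : (EuclideanSpace ℂ (Fin n)) → ℂ} {z : EuclideanSpace ℂ (Fin n)} (hf : ContDiffAt ℝ (⊤ : ℕ∞) f z) :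
    ContDiffAt ℝ (⊤ : ℕ∞) (wd k f) z := by
  have h1 : ContDiffAt ℝ (⊤ : ℕ∞) (fderiv ℝ f) z := hf.fderiv_right (by simp)
  unfold wd
  fun_prop

lemma contDiffAt_wdb {k : Fin n} {f : (EuclideanSpace ℂ (Fin n)) → ℂ} {z : EuclideanSpace ℂ (Fin n)} (hf : ContDiffAt ℝ (⊤ : ℕ∞) f z) :
    ContDiffAt ℝ (⊤ : ℕ∞) (wdb k f) z := by
  have h1 : ContDiffAt ℝ (⊤ : ℕ∞) (fderiv ℝ f) z := hf.fderiv_right (by simp)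
  unfold wdb
  fun_prop

lemma ev_diff {f : (EuclideanSpace ℂ (Fin n)) → ℂ} {z : EuclideanSpace ℂ (Fin n)} (hf : ContDiffAt ℝ (⊤ : ℕ∞) f z) :
    ∀ᶠ w in nhds z, DifferentiableAt ℝ f w := by
  have h1 : ContDiffAt ℝ 1 f z := hf.of_le (by exact_mod_cast le_top)
  filter_upwards [h1.eventually (by simp)] with w hw using hw.differentiableAt (by simp)

lemma diff {f : (EuclideanSpace ℂ (Fin n)) → ℂ} {z : EuclideanSpace ℂ (Fin n)} (hf : ContDiffAt ℝ (⊤ : ℕ∞) f z) :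
    DifferentiableAt ℝ f z := (ev_diff hf).self_of_nhds

lemma fderiv_wd {k : Fin n} {f : (EuclideanSpace ℂ (Fin n)) → ℂ} {z v : EuclideanSpace ℂ (Fin n)} (hf : ContDiffAt ℝ (⊤ : ℕ∞) f z) :
    fderiv ℝ (wd k f) z v = (1/2 : ℂ) * (fderiv ℝ (fderiv ℝ f) z v (EuclideanSpace.single k 1)
    - Complex.I * fderiv ℝ (fderiv ℝ f) z v (EuclideanSpace.single k Complex.I)) := by
  have h1 : ContDiffAt ℝ (⊤ : ℕ∞) (fderiv ℝ f) z := hf.fderiv_right (by simp)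
  have h2 : HasFDerivAt (fderiv ℝ f) (fderiv ℝ (fderiv ℝ f) z) z :=
    (h1.differentiableAt (by simp)).hasFDerivAt
  have h3 := fun u : EuclideanSpace ℂ (Fin n) => h2.clm_apply (hasFDerivAt_const u z)
  have h4 := ((h3 (EuclideanSpace.single k 1)).sub
    ((h3 (EuclideanSpace.single k Complex.I)).const_mul Complex.I)).const_mul (1/2 : ℂ)
  have h5 : HasFDerivAt (wd k f) _ z := h4
  rw [h5.fderiv]; simp

lemma fderiv_wdb {k : Fin n} {f : (EuclideanSpace ℂ (Fin n)) → ℂ} {z v : EuclideanSpace ℂ (Fin n)} (hf : ContDiffAt ℝ (⊤ : ℕ∞) f z) :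
    fderiv ℝ (wdb k f) z v = (1/2 : ℂ) * (fderiv ℝ (fderiv ℝ f) z v (EuclideanSpace.single k 1)
    + Complex.I * fderiv ℝ (fderiv ℝ f) z v (EuclideanSpace.single k Complex.I)) := by
  have h1 : ContDiffAt ℝ (⊤ : ℕ∞) (fderiv ℝ f) z := hf.fderiv_right (by simp)
  have h2 : HasFDerivAt (fderiv ℝ f) (fderiv ℝ (fderiv ℝ f) z) z :=
    (h1.differentiableAt (by simp)).hasFDerivAt
  have h3 := fun u : EuclideanSpace ℂ (Fin n) => h2.clm_apply (hasFDerivAt_const u z)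
  have h4 := ((h3 (EuclideanSpace.single k 1)).add
    ((h3 (EuclideanSpace.single k Complex.I)).const_mul Complex.I)).const_mul (1/2 : ℂ)
  have h5 : HasFDerivAt (wdb k f) _ z := h4
  rw [h5.fderiv]; simp; ring

lemma wdb_wd_comm {k l : Fin n} {f : (EuclideanSpace ℂ (Fin n)) → ℂ} {z : EuclideanSpace ℂ (Fin n)} (hf : ContDiffAt ℝ (⊤ : ℕ∞) f z) :
    wdb l (wd k f) z = wd k (wdb l f) z := by
  have hs : IsSymmSndFDerivAt ℝ f z := hf.isSymmSndFDerivAt (by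
    simp only [minSmoothness_of_isRCLikeNormedField]
    exact WithTop.coe_le_coe.2 (le_top : (2 : ℕ∞) ≤ ⊤))
  have e1 : wdb l (wd k f) z = (1/2 : ℂ) * (fderiv ℝ (wd k f) z (EuclideanSpace.single l 1)
    + Complex.I * fderiv ℝ (wd k f) z (EuclideanSpace.single l Complex.I)) := rfl
  have e2 : wd k (wdb l f) z = (1/2 : ℂ) * (fderiv ℝ (wdb l f) z (EuclideanSpace.single k 1)
    - Complex.I * fderiv ℝ (wdb l f) z (EuclideanSpace.single k Complex.I)) := rfl
  rw [e1, e2, fderiv_wd hf, fderiv_wd hf, fderiv_wdb hf, fderiv_wdb hf]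
  rw [hs (EuclideanSpace.single l 1), hs (EuclideanSpace.single l 1),
    hs (EuclideanSpace.single l I), hs (EuclideanSpace.single l I)]
  ring

/-- The mixed 2-jet of `f` at the origin in the directions `k`, `l̄`. -/
structure Jet (k l : Fin n) (f : (EuclideanSpace ℂ (Fin n)) → ℂ) (a b c d : ℂ) : Prop where
  sm : ContDiffAt ℝ (⊤ : ℕ∞) f 0
  v : f 0 = a
  dk : wd k f 0 = b
  dl : wdb l f 0 = c
  dd : wd k (wdb l f) 0 = d

lemma Jet.self {k l : Fin n} {f : (EuclideanSpace ℂ (Fin n)) → ℂ} (hf : ContDiffAt ℝ (⊤ : ℕ∞) f 0) :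
    Jet k l f (f 0) (wd k f 0) (wdb l f 0) (wd k (wdb l f) 0) := ⟨hf, rfl, rfl, rfl, rfl⟩

lemma Jet.cast {k l : Fin n} {f : (EuclideanSpace ℂ (Fin n)) → ℂ} {a b c d a' b' c' d' : ℂ}
    (hf : Jet k l f a b c d) (ha : a = a') (hb : b = b') (hc : c = c') (hd : d = d') :
    Jet k l f a' b' c' d' := by subst ha hb hc hd; exact hf

lemma Jet.const {k l : Fin n} (c : ℂ) : Jet k l (fun _ => c) c 0 0 0 :=
  ⟨contDiffAt_const, rfl, by rw [wd_const], by rw [wdb_const], by rw [wdb_const, wd_const]⟩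

lemma Jet.add {k l : Fin n} {f f' : (EuclideanSpace ℂ (Fin n)) → ℂ} {a b c d a' b' c' d' : ℂ}
    (hf : Jet k l f a b c d) (hf' : Jet k l f' a' b' c' d') :
    Jet k l (fun z => f z + f' z) (a + a') (b + b') (c + c') (d + d') := by
  refine ⟨hf.sm.add hf'.sm, by rw [hf.v, hf'.v], ?_, ?_, ?_⟩
  · rw [wd_add (diff hf.sm) (diff hf'.sm), hf.dk, hf'.dk]
  · rw [wdb_add (diff hf.sm) (diff hf'.sm), hf.dl, hf'.dl]
  · have : wdb l (fun z => f z + f' z) =ᶠ[nhds 0] fun z => wdb l f z + wdb l f' z := by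
      filter_upwards [ev_diff hf.sm, ev_diff hf'.sm] with w h1 h2 using wdb_add h1 h2
    rw [wd_congr this, wd_add (diff (contDiffAt_wdb hf.sm)) (diff (contDiffAt_wdb hf'.sm)),
      hf.dd, hf'.dd]

lemma Jet.mul {k l : Fin n} {f f' : (EuclideanSpace ℂ (Fin n)) → ℂ} {a b c d a' b' c' d' : ℂ}
    (hf : Jet k l f a b c d) (hf' : Jet k l f' a' b' c' d') :
    Jet k l (fun z => f z * f' z) (a * a') (b * a' + a * b') (c * a' + a * c')
      (d * a' + c * b' + (b * c' + a * d')) := by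
  refine ⟨hf.sm.mul hf'.sm, by rw [hf.v, hf'.v], ?_, ?_, ?_⟩
  · rw [wd_mul (diff hf.sm) (diff hf'.sm), hf.dk, hf'.dk, hf.v, hf'.v]
  · rw [wdb_mul (diff hf.sm) (diff hf'.sm), hf.dl, hf'.dl, hf.v, hf'.v]
  · have : wdb l (fun z => f z * f' z) =ᶠ[nhds 0]
        fun z => wdb l f z * f' z + f z * wdb l f' z := by
      filter_upwards [ev_diff hf.sm, ev_diff hf'.sm] with w h1 h2 using wdb_mul h1 h2
    have s1 := contDiffAt_wdb (k := l) hf.sm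
    have s2 := contDiffAt_wdb (k := l) hf'.sm
    rw [wd_congr this, wd_add (diff (s1.mul hf'.sm)) (diff (hf.sm.mul s2)),
      wd_mul (diff s1) (diff hf'.sm), wd_mul (diff hf.sm) (diff s2),
      hf.dd, hf'.dd, hf.dl, hf'.dl, hf.dk, hf'.dk, hf.v, hf'.v]

lemma Jet.sum {k l : Fin n} {ι : Type*} (s : Finset ι) {f : ι → (EuclideanSpace ℂ (Fin n)) → ℂ} {a b c d : ι → ℂ}
    (hf : ∀ i ∈ s, Jet k l (f i) (a i) (b i) (c i) (d i)) :
    Jet k l (fun z => ∑ i ∈ s, f i z) (∑ i ∈ s, a i) (∑ i ∈ s, b i) (∑ i ∈ s, c i)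
      (∑ i ∈ s, d i) := by
  classical
  induction s using Finset.induction_on with
  | empty => simpa using Jet.const (k := k) (l := l) 0
  | insert i s hi ih =>
    simp only [Finset.sum_insert hi]
    exact (hf i (by simp)).add (ih fun j hj => hf j (by simp [hj]))

lemma Jet.coord (k l i : Fin n) : Jet k l (fun z => z i) 0 (if i = k then 1 else 0) 0 0 := by
  refine ⟨?_, rfl, by rw [wd_coord], by rw [wdb_coord], by rw [wdb_coord, wd_const]⟩
  exact ((EuclideanSpace.proj i : (EuclideanSpace ℂ (Fin n)) →L[ℂ] ℂ).restrictScalars ℝ).contDiff.contDiffAt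

lemma contDiffAt_conj {f : (EuclideanSpace ℂ (Fin n)) → ℂ} {z : EuclideanSpace ℂ (Fin n)} (hf : ContDiffAt ℝ (⊤ : ℕ∞) f z) :
    ContDiffAt ℝ (⊤ : ℕ∞) (fun w => (starRingEnd ℂ) (f w)) z :=
  (Complex.conjCLE : ℂ ≃L[ℝ] ℂ).contDiff.contDiffAt.comp z hf

lemma Jet.coordbar (k l i : Fin n) :
    Jet k l (fun z => (starRingEnd ℂ) (z i)) 0 0 (if i = l then 1 else 0) 0 := by
  have e : wdb l (fun z : EuclideanSpace ℂ (Fin n) => (starRingEnd ℂ) (z i)) = fun _ => if i = l then 1 else 0 := by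
    funext z
    rw [wdb_conj (fun z : EuclideanSpace ℂ (Fin n) => z i), wd_coord]
    split_ifs <;> simp
  refine ⟨contDiffAt_conj (Jet.coord k l i).sm, by simp, ?_, by rw [e], by rw [e, wd_const]⟩
  rw [wd_conj (fun z : EuclideanSpace ℂ (Fin n) => z i), wdb_coord]; simp

lemma contDiffAt_det {m : ℕ} {M : (EuclideanSpace ℂ (Fin n)) → Matrix (Fin m) (Fin m) ℂ} {z : EuclideanSpace ℂ (Fin n)}
    (hM : ∀ i j, ContDiffAt ℝ (⊤ : ℕ∞) (fun w => M w i j) z) :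
    ContDiffAt ℝ (⊤ : ℕ∞) (fun w => (M w).det) z := by
  simp only [Matrix.det_apply']
  refine ContDiffAt.sum fun σ _ => contDiffAt_const.mul ?_
  exact contDiffAt_prod fun i _ => hM _ _

lemma contDiffAt_ginv {g : Fin n → Fin n → (EuclideanSpace ℂ (Fin n)) → ℂ} {z : EuclideanSpace ℂ (Fin n)}
    (hg : ∀ i j, ContDiffAt ℝ (⊤ : ℕ∞) (g i j) z)
    (hd : (Matrix.of fun i j => g i j z).det ≠ 0) (i j : Fin n) :
    ContDiffAt ℝ (⊤ : ℕ∞) (fun w => ginv g w i j) z := by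
  have e : (fun w => ginv g w i j) = fun w => ((Matrix.of fun i j => g i j w).det)⁻¹ *
      ((Matrix.of fun i j => g i j w).updateRow i (Pi.single j 1)).det := by
    funext w
    simp [ginv, Matrix.inv_def, Matrix.adjugate_apply]
  rw [e]
  refine ContDiffAt.mul (ContDiffAt.inv (contDiffAt_det fun a b => ?_) hd)
    (contDiffAt_det fun a b => ?_)
  · simpa using hg a b
  · by_cases hai : a = i
    · subst hai; simpa using contDiffAt_const
    · simpa [Matrix.updateRow_ne hai] using hg a b

end JetAux

open JetAux

/-- In the normalized local setup at the origin,
`(∂_k ∂_l̄ H^{ij̄})(0) = (∂_k ∂_l̄ g^{ij̄})(0) − (δ^{ij} δ_{kl} + δ^i_k δ^j_l)`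
for `1 ≤ i, j, k, l ≤ n`. -/
theorem ddbarHmat_at_origin
    (n : ℕ) (Ω : Set (EuclideanSpace ℂ (Fin n)))
    (hΩ : IsOpen Ω) (h0Ω : (0 : EuclideanSpace ℂ (Fin n)) ∈ Ω)
    -- `g_{ij̄} = ∂_i∂_j̄ φ` is positive definite on the neighborhood `Ω` of `0`:
    (φ : EuclideanSpace ℂ (Fin n) → ℝ) (hφ : ContDiffOn ℝ (⊤ : ℕ∞) φ Ω)
    (g : Fin n → Fin n → EuclideanSpace ℂ (Fin n) → ℂ)
    (hgφ : ∀ i j : Fin n, ∀ z ∈ Ω, g i j z = wd i (wdb j (fun w => (φ w : ℂ))) z)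
    (hposdef : ∀ z ∈ Ω, (Matrix.of fun i j => g i j z).PosDef)
    -- normalization of `g` at the origin:
    (hg0 : ∀ i j : Fin n, g i j 0 = if i = j then 1 else 0)
    (hdg0 : ∀ i j k : Fin n, wd k (g i j) 0 = 0 ∧ wdb k (g i j) 0 = 0)
    -- `h` is a smooth positive function with `g = −∂∂̄ log h`, normalized at the origin:
    (h : EuclideanSpace ℂ (Fin n) → ℝ) (hsm : ContDiffOn ℝ (⊤ : ℕ∞) h Ω)
    (hpos : ∀ z ∈ Ω, 0 < h z)
    (hgh : ∀ i j : Fin n, ∀ z ∈ Ω,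
      g i j z = -wd i (wdb j (fun w => (Real.log (h w) : ℂ))) z)
    (hh0 : h 0 = 1) (hdh0 : fderiv ℝ h 0 = 0)
    (hh2 : ∀ i j : Fin n, wd i (wd j (fun w => (h w : ℂ))) 0 = 0
      ∧ wdb i (wdb j (fun w => (h w : ℂ))) 0 = 0)
    :
    ∀ i j k l : Fin n,
      wd k (wdb l (Hmat h g i.succ j.succ)) 0
        = wd k (wdb l (fun z => ginv g z i j)) 0
          - ((if i = j then 1 else 0) * (if k = l then 1 else 0)
            + (if i = k then 1 else 0) * (if j = l then 1 else 0)) := by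
  intro i j k l
  have hN : Ω ∈ nhds (0 : EuclideanSpace ℂ (Fin n)) := hΩ.mem_nhds h0Ω
  have ofR : ∀ f : EuclideanSpace ℂ (Fin n) → ℝ, ContDiffAt ℝ (⊤ : ℕ∞) f 0 →
      ContDiffAt ℝ (⊤ : ℕ∞) (fun w => (f w : ℂ)) 0 := fun f hf =>
    Complex.ofRealCLM.contDiff.contDiffAt.comp _ hf
  have hφs : ContDiffAt ℝ (⊤ : ℕ∞) (fun w => (φ w : ℂ)) 0 := ofR φ (hφ.contDiffAt hN)
  have hs : ContDiffAt ℝ (⊤ : ℕ∞) (fun w => (h w : ℂ)) 0 := ofR h (hsm.contDiffAt hN)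
  have hgs : ∀ a b, ContDiffAt ℝ (⊤ : ℕ∞) (g a b) 0 := fun a b =>
    (contDiffAt_wd (k := a) (contDiffAt_wdb (k := b) hφs)).congr_of_eventuallyEq
      (by filter_upwards [hN] with z hz using hgφ a b z hz)
  have hunit : ∀ z ∈ Ω, IsUnit (Matrix.of fun i j => g i j z).det := fun z hz =>
    (Matrix.isUnit_iff_isUnit_det _).1 (hposdef z hz).isUnit
  have hGs : ∀ a b, ContDiffAt ℝ (⊤ : ℕ∞) (fun w => ginv g w a b) 0 :=
    contDiffAt_ginv hgs (hunit 0 h0Ω).ne_zero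
  have hdh : ∀ v, fderiv ℝ (fun w => (h w : ℂ)) 0 v = 0 := by
    intro v
    have h1 : HasFDerivAt h (fderiv ℝ h 0) 0 :=
      ((hsm.contDiffAt hN).differentiableAt (by simp)).hasFDerivAt
    have h2 : HasFDerivAt (fun w => (h w : ℂ)) (Complex.ofRealCLM.comp (fderiv ℝ h 0)) 0 :=
      Complex.ofRealCLM.hasFDerivAt.comp (0 : EuclideanSpace ℂ (Fin n)) h1
    rw [h2.fderiv, hdh0]; simp
  have hwd : ∀ p, wd p (fun w => (h w : ℂ)) 0 = 0 := by intro p; simp [wd, hdh]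
  have hwdb : ∀ p, wdb p (fun w => (h w : ℂ)) 0 = 0 := by intro p; simp [wdb, hdh]
  have hinv : ContDiffAt ℝ (⊤ : ℕ∞) (fun w => (h w : ℂ)⁻¹) 0 := hs.inv (by simp [hh0])
  -- mixed second derivatives of `h` at the origin
  have hdd : ∀ a b, wd a (wdb b (fun w => (h w : ℂ))) 0 = -(if a = b then 1 else 0) := by
    intro a b
    have e : wdb b (fun w => (Real.log (h w) : ℂ)) =ᶠ[nhds 0]
        fun z => (h z : ℂ)⁻¹ * wdb b (fun w => (h w : ℂ)) z := by
      filter_upwards [hN] with z hz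
      have h1 : HasFDerivAt h (fderiv ℝ h z) z :=
        ((hsm.contDiffAt (hΩ.mem_nhds hz)).differentiableAt (by simp)).hasFDerivAt
      have h2 : HasFDerivAt (fun w => (h w : ℂ)) (Complex.ofRealCLM.comp (fderiv ℝ h z)) z :=
        Complex.ofRealCLM.hasFDerivAt.comp z h1
      have h3 : HasFDerivAt (fun w => (Real.log (h w) : ℂ))
          (Complex.ofRealCLM.comp ((h z)⁻¹ • fderiv ℝ h z)) z :=
        Complex.ofRealCLM.hasFDerivAt.comp z (h1.log (hpos z hz).ne')
      unfold wdb
      rw [h2.fderiv, h3.fderiv]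
      simp; ring
    have := hgh a b 0 h0Ω
    rw [wd_congr e, wd_mul (diff hinv) (diff (contDiffAt_wdb hs)), hwdb, hg0, hh0] at this
    rw [this]; simp
  -- jets
  have Jh : Jet k l (fun w => (h w : ℂ)) 1 0 0 (-(if k = l then 1 else 0)) :=
    ⟨hs, by simp [hh0], hwd k, hwdb l, hdd k l⟩
  have hG0 : ∀ a b, ginv g 0 a b = if a = b then 1 else 0 := by
    intro a b
    have : (Matrix.of fun i j => g i j 0) = (1 : Matrix (Fin n) (Fin n) ℂ) := by
      ext a b; simp [hg0, Matrix.one_apply]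
    simp [ginv, this, Matrix.one_apply, eq_comm]
  have JG : ∀ a b, Jet k l (fun z => ginv g z a b) (if a = b then 1 else 0) 0 0
      (wd k (wdb l (fun z => ginv g z a b)) 0) := by
    intro a b
    -- differentiate `∑ p, g^{pā} g_{pb̄} = δ`
    have Jp : ∀ p ∈ Finset.univ, _ := fun p (_ : p ∈ (Finset.univ : Finset (Fin n))) =>
      (Jet.self (k := k) (l := l) (hGs a p)).mul (Jet.self (hgs b p))
    have Js := Jet.sum Finset.univ Jp
    have e : (fun z => ∑ p, ginv g z a p * g b p z) =ᶠ[nhds 0]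
        fun _ => if a = b then (1 : ℂ) else 0 := by
      filter_upwards [hN] with z hz
      have := congrFun (congrFun (Matrix.mul_nonsing_inv _ (hunit z hz)) b) a
      simp only [Matrix.mul_apply, Matrix.of_apply, Matrix.one_apply] at this
      simp only [ginv, Matrix.transpose_apply, mul_comm _ (g b _ z), eq_comm (a := a)]
      exact this
    have e1 := Js.dk
    have e2 := Js.dl
    rw [wd_congr e, wd_const] at e1
    rw [wdb_congr e, wdb_const] at e2
    simp [hg0, (hdg0 _ _ _).1, (hdg0 _ _ _).2] at e1 e2
    exact ⟨hGs a b, hG0 a b, e1.symm, e2.symm, rfl⟩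
  have hconj : ∀ q z, (starRingEnd ℂ) (wd q (fun w => (h w : ℂ)) z)
      = wdb q (fun w => (h w : ℂ)) z := by
    intro q z
    rw [← wdb_conj]; simp
  have JA : ∀ p, Jet k l (fun z => (if i = p then 1 else 0)
      + z i * ((h z : ℂ)⁻¹ * wd p (fun w => (h w : ℂ)) z)) (if i = p then 1 else 0) 0 0
      (-((if i = k then 1 else 0) * (if p = l then 1 else 0))) := by
    intro p
    refine ((Jet.const _).add ((Jet.coord k l i).mul
      ((Jet.self hinv).mul (Jet.self (contDiffAt_wd (k := p) hs))))).cast ?_ ?_ ?_ ?_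
    all_goals simp [hwd, hh0, wdb_wd_comm hs, hdd]
  have JB : ∀ q, Jet k l (fun z => (if j = q then 1 else 0)
      + (starRingEnd ℂ) (z j) * ((h z : ℂ)⁻¹ * wdb q (fun w => (h w : ℂ)) z))
      (if j = q then 1 else 0) 0 0
      (-((if j = l then 1 else 0) * (if k = q then 1 else 0))) := by
    intro q
    refine ((Jet.const _).add ((Jet.coordbar k l j).mul
      ((Jet.self hinv).mul (Jet.self (contDiffAt_wdb (k := q) hs))))).cast ?_ ?_ ?_ ?_
    all_goals simp [hwdb, hh0, hdd]
  have JS := Jet.sum Finset.univ fun p (_ : p ∈ (Finset.univ : Finset (Fin n))) =>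
    Jet.sum Finset.univ fun q (_ : q ∈ (Finset.univ : Finset (Fin n))) =>
      ((JG p q).mul (JA p)).mul (JB q)
  have JH := (((Jh.mul (Jet.coord k l i)).mul (Jet.coordbar k l j))).add (Jh.mul JS)
  have uue : ∀ a : Fin n, uu (n := n) a.succ = fun z => z a := by
    intro a; funext z; simp [uu]
  have eH : Hmat h g i.succ j.succ = fun z => (h z : ℂ) * z i * (starRingEnd ℂ) (z j)
      + (h z : ℂ) * ∑ p, ∑ q, ginv g z p q
        * ((if i = p then 1 else 0) + z i * ((h z : ℂ)⁻¹ * wd p (fun w => (h w : ℂ)) z))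
        * ((if j = q then 1 else 0)
          + (starRingEnd ℂ) (z j) * ((h z : ℂ)⁻¹ * wdb q (fun w => (h w : ℂ)) z)) := by
    funext z
    simp only [Hmat, uue, wd_coord, map_add, map_mul, hconj, map_inv₀, Complex.conj_ofReal,
      mul_assoc, apply_ite (starRingEnd ℂ), map_one, map_zero]
  rw [eH, JH.dd]
  simp only [mul_zero, zero_mul, add_zero, zero_add, one_mul, add_mul, Finset.sum_add_distrib]
  clear * -
  simp
  split_ifs <;> simp_all <;> ring
end
end
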